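/- arXiv:1403.0372 — 2 statements merged into one kernel-verified Lean document; each statement's English description precedes it below -/
import Mathlib

section
/- Let 0<α<1, 1<p<1/α, and q = p/(1−αp). There exists a constant c depending only on p and α such that for every weight w ∈ A_{p,q}^-(ℝ), the Riemann–Liouville operator R_α is bounded from L^p_{w^p}(ℝ) to the weak space L^{q,∞}_{w^q}(ℝ) with ‖R_α‖_{L^p_{w^p}→L^{q,∞}_{w^q}} ≤ c ‖w‖_{A_{p,q}^-(ℝ)}^{1-α}. -/
open MeasureTheory Set Filter
open scoped ENNReal

noncomputable section

/-- A weight on `ℝ`: an a.e. positive, locally integrable function. -/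
def IsWeight (w : ℝ → ℝ) : Prop :=
  (∀ᵐ x : ℝ, 0 < w x) ∧ MeasureTheory.LocallyIntegrable w MeasureTheory.volume

/-- `∫_a^b w` as a lower integral. -/
def lintIoc (w : ℝ → ℝ) (a b : ℝ) : ℝ≥0∞ :=
  ∫⁻ t in Set.Ioc a b, ENNReal.ofReal (w t)

/-- Average `(1/(b-a)) ∫_a^b w`. -/
def avgIoc (w : ℝ → ℝ) (a b : ℝ) : ℝ≥0∞ :=
  (ENNReal.ofReal (b - a))⁻¹ * lintIoc w a b

/-- The one-sided `A_{p,q}^-` characteristic: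
`sup_{x,h>0} ((1/h)∫_x^{x+h} u^q)((1/h)∫_{x-h}^x u^{-p'})^{q/p'}`, `p' = p/(p-1)`. -/
def apqMinusChar (p q : ℝ) (u : ℝ → ℝ) : ℝ≥0∞ :=
  ⨆ (x : ℝ) (h : ℝ) (_ : 0 < h),
    avgIoc (fun t => u t ^ q) x (x + h) *
      avgIoc (fun t => u t ^ (-(p / (p - 1)))) (x - h) x ^ (q / (p / (p - 1)))

/-- Weighted `L^p` "norm" `(∫ g^p w)^{1/p}` of an `ℝ≥0∞`-valued function. -/
def lnormW (p : ℝ) (w : ℝ → ℝ) (g : ℝ → ℝ≥0∞) : ℝ≥0∞ :=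
  (∫⁻ x : ℝ, g x ^ p * ENNReal.ofReal (w x)) ^ (1 / p)

/-- Weighted weak `L^q` quasinorm
`sup_{λ>0} λ (v{x : g(x) > λ})^{1/q}` of an `ℝ≥0∞`-valued function. -/
def wkNormW (q : ℝ) (v : ℝ → ℝ) (g : ℝ → ℝ≥0∞) : ℝ≥0∞ :=
  ⨆ (l : ℝ) (_ : 0 < l),
    ENNReal.ofReal l *
      (∫⁻ x in {x : ℝ | ENNReal.ofReal l < g x}, ENNReal.ofReal (v x)) ^ (1 / q)

/-- The Riemann–Liouville fractional integral (applied to `|f|`):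
`R_α f(x) = ∫_{-∞}^x |f(t)| (x-t)^{α-1} dt`. -/
def Ralpha (α : ℝ) (f : ℝ → ℝ) (x : ℝ) : ℝ≥0∞ :=
  ∫⁻ t in Set.Iio x, ENNReal.ofReal (|f t| * (x - t) ^ (α - 1))


lemma cover_aux (s : Finset (ℝ × ℝ)) : ∃ s' ⊆ s,
    (⋃ i ∈ s', Ioo i.1 i.2) = (⋃ i ∈ s, Ioo i.1 i.2) ∧
    ∀ x : ℝ, (s'.filter (fun i => x ∈ Ioo i.1 i.2)).card ≤ 2 := by
  classical
  induction s using Finset.strongInduction with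
  | H s ih =>
    by_cases h : ∀ x : ℝ, (s.filter (fun i => x ∈ Ioo i.1 i.2)).card ≤ 2
    · exact ⟨s, subset_rfl, rfl, h⟩
    · push Not at h
      obtain ⟨x, hx⟩ := h
      set T := s.filter (fun i => x ∈ Ioo i.1 i.2) with hT
      have hne : T.Nonempty := Finset.card_pos.mp (by omega)
      obtain ⟨A, hA, hAm⟩ := T.exists_min_image (fun i => i.1) hne
      obtain ⟨B, hB, hBm⟩ := T.exists_max_image (fun i => i.2) hne
      have : ∃ c ∈ T, c ∉ ({A, B} : Finset (ℝ × ℝ)) := by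
        by_contra hc
        push Not at hc
        have := Finset.card_le_card (show T ⊆ {A, B} from hc)
        have := Finset.card_le_two (a := A) (b := B)
        omega
      obtain ⟨c, hc, hcn⟩ := this
      simp only [Finset.mem_insert, Finset.mem_singleton, not_or] at hcn
      have hcs : c ∈ s := (Finset.mem_filter.mp hc).1
      obtain ⟨s', hs', hU, hcard⟩ := ih (s.erase c) (Finset.erase_ssubset hcs)
      refine ⟨s', hs'.trans (Finset.erase_subset _ _), ?_, hcard⟩
      rw [hU]
      apply Subset.antisymm
      · exact biUnion_subset_biUnion_left (fun i hi => Finset.mem_of_mem_erase hi)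
      · intro y hy
        simp only [mem_iUnion, exists_prop] at hy ⊢
        obtain ⟨i, hi, hyi⟩ := hy
        by_cases hic : i = c
        · subst hic
          have h1 := hAm i hc
          have h2 := hBm i hc
          have hAx := (Finset.mem_filter.mp hA)
          have hBx := (Finset.mem_filter.mp hB)
          rcases lt_or_ge y x with hyx | hyx
          · exact ⟨A, Finset.mem_erase.mpr ⟨fun h => hcn.1 h.symm, hAx.1⟩,
              lt_of_le_of_lt h1 hyi.1, hyx.trans hAx.2.2⟩
          · exact ⟨B, Finset.mem_erase.mpr ⟨fun h => hcn.2 h.symm, hBx.1⟩,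
              lt_of_lt_of_le hBx.2.1 hyx, lt_of_lt_of_le hyi.2 h2⟩
        · exact ⟨i, Finset.mem_erase.mpr ⟨hic, hi⟩, hyi⟩

lemma cover_bound (μ : Measure ℝ) (F : ℝ → ℝ≥0∞) (hF : Measurable F) (l : ℝ≥0∞)
    (s : Finset (ℝ × ℝ))
    (hs : ∀ i ∈ s, l * μ (Ioo i.1 i.2) ≤ ∫⁻ x in Ioo i.1 i.2, F x ∂μ) :
    l * μ (⋃ i ∈ s, Ioo i.1 i.2) ≤ 2 * ∫⁻ x, F x ∂μ := by
  classical
  obtain ⟨s', hs', hU, hcard⟩ := cover_aux s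
  rw [← hU]
  calc l * μ (⋃ i ∈ s', Ioo i.1 i.2) ≤ l * ∑ i ∈ s', μ (Ioo i.1 i.2) := by
        gcongr; exact measure_biUnion_finset_le _ _
    _ = ∑ i ∈ s', l * μ (Ioo i.1 i.2) := Finset.mul_sum _ _ _
    _ ≤ ∑ i ∈ s', ∫⁻ x in Ioo i.1 i.2, F x ∂μ := Finset.sum_le_sum fun i hi => hs i (hs' hi)
    _ = ∑ i ∈ s', ∫⁻ x, (Ioo i.1 i.2).indicator F x ∂μ := by
        refine Finset.sum_congr rfl fun i _ => ?_
        rw [lintegral_indicator measurableSet_Ioo]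
    _ = ∫⁻ x, ∑ i ∈ s', (Ioo i.1 i.2).indicator F x ∂μ := by
        rw [lintegral_finsetSum]
        exact fun i _ => hF.indicator measurableSet_Ioo
    _ ≤ ∫⁻ x, 2 * F x ∂μ := by
        refine lintegral_mono fun x => ?_
        simp only [Set.indicator_apply]
        rw [← Finset.sum_filter, Finset.sum_const, nsmul_eq_mul]
        gcongr
        exact_mod_cast hcard x
    _ = 2 * ∫⁻ x, F x ∂μ := lintegral_const_mul _ hF

/-- uncentered maximal function -/
def MU (μ : Measure ℝ) (F : ℝ → ℝ≥0∞) (t : ℝ) : ℝ≥0∞ :=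
  ⨆ (i : ℝ × ℝ) (_ : t ∈ Ioo i.1 i.2), (∫⁻ x in Ioo i.1 i.2, F x ∂μ) / μ (Ioo i.1 i.2)

lemma MU_set (μ : Measure ℝ) (F : ℝ → ℝ≥0∞) (l : ℝ≥0∞) :
    {t | l < MU μ F t} = ⋃ i ∈ {i : ℝ × ℝ | l < (∫⁻ x in Ioo i.1 i.2, F x ∂μ) / μ (Ioo i.1 i.2)},
      Ioo i.1 i.2 := by
  ext t
  simp only [MU, mem_ofPred_eq, lt_iSup_iff, mem_iUnion, exists_prop]
  constructor
  · rintro ⟨i, h1, h2⟩; exact ⟨i, h2, h1⟩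
  · rintro ⟨i, h1, h2⟩; exact ⟨i, h2, h1⟩

lemma MU_measurable (μ : Measure ℝ) (F : ℝ → ℝ≥0∞) : Measurable (MU μ F) := by
  refine measurable_of_Ioi fun l => ?_
  have : MU μ F ⁻¹' Ioi l = {t | l < MU μ F t} := rfl
  rw [this, MU_set]
  exact (isOpen_biUnion fun i _ => isOpen_Ioo).measurableSet

lemma MU_weak (μ : Measure ℝ) (F : ℝ → ℝ≥0∞) (hF : Measurable F) (l : ℝ≥0∞) :
    l * μ {t | l < MU μ F t} ≤ 2 * ∫⁻ x, F x ∂μ := by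
  classical
  rw [MU_set]
  set S := {i : ℝ × ℝ | l < (∫⁻ x in Ioo i.1 i.2, F x ∂μ) / μ (Ioo i.1 i.2)} with hS
  obtain ⟨T, hTS, hTc, hTU⟩ := TopologicalSpace.isOpen_biUnion_countable S (fun i => Ioo i.1 i.2)
    (fun i _ => isOpen_Ioo)
  rw [← hTU]
  rcases T.eq_empty_or_nonempty with hTe | hTn
  · simp [hTe]
  obtain ⟨φ, hφ⟩ := hTc.exists_eq_range hTn
  have hU : (⋃ i ∈ T, Ioo i.1 i.2) = ⋃ n, Ioo (φ n).1 (φ n).2 := by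
    rw [hφ, biUnion_range]
  rw [hU, measure_iUnion_eq_iSup_accumulate, ENNReal.mul_iSup]
  refine iSup_le fun n => ?_
  have hacc : accumulate (fun n => Ioo (φ n).1 (φ n).2) n
      = ⋃ i ∈ (Finset.range (n+1)).image φ, Ioo i.1 i.2 := by
    ext x
    simp [accumulate_def]
  rw [hacc]
  refine cover_bound μ F hF l _ ?_
  intro i hi
  obtain ⟨k, _, rfl⟩ := Finset.mem_image.mp hi
  have : φ k ∈ S := hTS (hφ ▸ mem_range_self k)
  exact (ENNReal.mul_lt_of_lt_div this).le

lemma pw_int (a : ℝ) (ha : 0 < a) (Y : ℝ) (hY : 0 ≤ Y) :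
    ∫⁻ l in Ioo 0 Y, ENNReal.ofReal (l ^ (a - 1)) = ENNReal.ofReal (Y ^ a / a) := by
  have h1 : IntervalIntegrable (fun l : ℝ => l ^ (a-1)) volume 0 Y :=
    intervalIntegral.intervalIntegrable_rpow' (by linarith)
  rw [intervalIntegrable_iff_integrableOn_Ioo_of_le hY] at h1
  rw [← ofReal_integral_eq_lintegral_ofReal h1, ← integral_Ioc_eq_integral_Ioo,
    ← intervalIntegral.integral_of_le hY, integral_rpow (Or.inl (by linarith))]
  · simp [Real.zero_rpow ha.ne']
  · filter_upwards [self_mem_ae_restrict measurableSet_Ioo] with x hx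
    exact Real.rpow_nonneg hx.1.le _

lemma layer_eq (a : ℝ) (ha : 0 < a) (Y : ℝ) (hY : 0 ≤ Y) :
    ∫⁻ l in Ioi (0:ℝ), (if ENNReal.ofReal l < ENNReal.ofReal Y then ENNReal.ofReal (l ^ (a - 1)) else 0)
      = ENNReal.ofReal (Y ^ a / a) := by
  rw [← pw_int a ha Y hY, ← lintegral_indicator measurableSet_Ioo,
    ← lintegral_indicator measurableSet_Ioi]
  congr 1
  ext l
  by_cases hl : 0 < l
  · by_cases h2 : l < Y
    · have : ENNReal.ofReal l < ENNReal.ofReal Y :=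
        (ENNReal.ofReal_lt_ofReal_iff (hl.trans h2)).mpr h2
      simp [hl, h2, this]
    · have : ¬ ENNReal.ofReal l < ENNReal.ofReal Y := by
        push Not at h2 ⊢
        exact ENNReal.ofReal_le_ofReal h2
      simp [h2, this]
  · simp [hl]

lemma layer_ge (a : ℝ) (ha : 0 < a) (y : ℝ≥0∞) :
    y ^ a ≤ ENNReal.ofReal a * ∫⁻ l in Ioi (0:ℝ),
      (if ENNReal.ofReal l < y then ENNReal.ofReal (l ^ (a - 1)) else 0) := by
  have key : ∀ Y : ℝ, 0 ≤ Y → ENNReal.ofReal Y ≤ y → ENNReal.ofReal Y ^ a ≤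
      ENNReal.ofReal a * ∫⁻ l in Ioi (0:ℝ),
      (if ENNReal.ofReal l < y then ENNReal.ofReal (l ^ (a - 1)) else 0) := by
    intro Y hY hy
    calc ENNReal.ofReal Y ^ a = ENNReal.ofReal a * ENNReal.ofReal (Y ^ a / a) := by
          rw [← ENNReal.ofReal_mul ha.le, ENNReal.ofReal_rpow_of_nonneg hY ha.le]
          congr 1; field_simp
      _ = _ := by rw [← layer_eq a ha Y hY]
      _ ≤ _ := by
          gcongr with l
          split_ifs with h1 h2
          · exact le_rfl
          · exact absurd (h1.trans_le hy) h2
          · exact zero_le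
          · exact le_rfl
  by_cases hy : y = ∞
  · subst hy
    rw [ENNReal.top_rpow_of_pos ha]
    refine le_of_eq ?_
    symm
    refine ENNReal.eq_top_of_forall_nnreal_le fun n => ?_
    have := key ((n:ℝ) ^ (1/a)) (by positivity) le_top
    rw [ENNReal.ofReal_rpow_of_nonneg (by positivity) ha.le, ← Real.rpow_mul (by positivity)] at this
    rw [one_div_mul_cancel ha.ne', Real.rpow_one, ENNReal.ofReal_coe_nnreal] at this
    exact this
  · have := key y.toReal ENNReal.toReal_nonneg (by rw [ENNReal.ofReal_toReal hy])
    rwa [ENNReal.ofReal_toReal hy] at this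

lemma layer_le (a : ℝ) (ha : 0 < a) (y : ℝ≥0∞) :
    ∫⁻ l in Ioi (0:ℝ),
      (if ENNReal.ofReal l < y then ENNReal.ofReal (l ^ (a - 1)) else 0)
       ≤ ENNReal.ofReal (1/a) * y ^ a := by
  by_cases hy : y = ∞
  · subst hy
    rw [ENNReal.top_rpow_of_pos ha, ENNReal.mul_top]
    · exact le_top
    · simpa using ha
  · have := layer_eq a ha y.toReal ENNReal.toReal_nonneg
    rw [ENNReal.ofReal_toReal hy] at this
    rw [this]
    rw [div_eq_mul_one_div, mul_comm, ENNReal.ofReal_mul (by positivity),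
      ← ENNReal.ofReal_rpow_of_nonneg ENNReal.toReal_nonneg ha.le, ENNReal.ofReal_toReal hy]

lemma MU_trunc (μ : Measure ℝ) (F : ℝ → ℝ≥0∞) (hF : Measurable F) (l : ℝ) (hl : 0 < l) :
    μ {t | ENNReal.ofReal l < MU μ F t} ≤
      ENNReal.ofReal (4 / l) * ∫⁻ x, (if ENNReal.ofReal l < 2 * F x then F x else 0) ∂μ := by
  set c := ENNReal.ofReal (l/2) with hc
  have hc0 : c ≠ 0 := by simp [hc, hl]
  have hct : c ≠ ∞ := ENNReal.ofReal_ne_top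
  have hcc : c + c = ENNReal.ofReal l := by
    rw [hc, ← ENNReal.ofReal_add (by positivity) (by positivity)]; congr 1; ring
  set F' : ℝ → ℝ≥0∞ := fun x => if ENNReal.ofReal l < 2 * F x then F x else 0 with hF'
  have hF'm : Measurable F' :=
    Measurable.ite (measurableSet_lt measurable_const (hF.const_mul 2)) hF measurable_const
  have hle : ∀ x, F x ≤ F' x + c := by
    intro x
    simp only [hF']
    split_ifs with h
    · exact le_self_add
    · rw [zero_add]
      push Not at h
      rw [← hcc, ← two_mul] at h
      exact (ENNReal.mul_le_mul_iff_right (by norm_num) (by norm_num)).mp h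
  have hsub : {t | ENNReal.ofReal l < MU μ F t} ⊆ {t | c < MU μ F' t} := by
    intro t ht
    simp only [mem_ofPred_eq] at ht ⊢
    by_contra hcon
    push Not at hcon
    refine absurd ht (not_lt.mpr ?_)
    refine iSup₂_le fun i hi => ?_
    calc (∫⁻ x in Ioo i.1 i.2, F x ∂μ) / μ (Ioo i.1 i.2)
        ≤ (∫⁻ x in Ioo i.1 i.2, (F' x + c) ∂μ) / μ (Ioo i.1 i.2) := by
          gcongr with x; exact hle x
      _ = (∫⁻ x in Ioo i.1 i.2, F' x ∂μ) / μ (Ioo i.1 i.2)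
          + c * μ (Ioo i.1 i.2) / μ (Ioo i.1 i.2) := by
          rw [lintegral_add_left hF'm, lintegral_const, Measure.restrict_apply_univ,
            ENNReal.add_div]
      _ ≤ c + c := by
          gcongr
          · exact le_trans (le_iSup₂ (f := fun (i : ℝ × ℝ) (_ : t ∈ Ioo i.1 i.2) =>
              (∫⁻ x in Ioo i.1 i.2, F' x ∂μ) / μ (Ioo i.1 i.2)) i hi) hcon
          · rw [mul_div_assoc]
            exact mul_le_of_le_one_right' ENNReal.div_self_le_one
      _ = _ := hcc
  have hw := MU_weak μ F' hF'm c
  have h4 : ENNReal.ofReal (4 / l) = c⁻¹ * 2 := by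
    rw [hc, ← ENNReal.ofReal_inv_of_pos (by positivity),
      show (2:ℝ≥0∞) = ENNReal.ofReal 2 by simp, ← ENNReal.ofReal_mul (by positivity)]
    congr 1; field_simp; norm_num
  calc _ ≤ μ {t | c < MU μ F' t} := measure_mono hsub
    _ = c⁻¹ * (c * μ {t | c < MU μ F' t}) := by
        rw [← mul_assoc, ENNReal.inv_mul_cancel hc0 hct, one_mul]
    _ ≤ c⁻¹ * (2 * ∫⁻ x, F' x ∂μ) := by gcongr
    _ = _ := by rw [h4, mul_assoc]

lemma MU_strong (μ : Measure ℝ) [SFinite μ] (F : ℝ → ℝ≥0∞) (hF : Measurable F) (r : ℝ) (hr : 1 < r) :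
    ∫⁻ x, MU μ F x ^ r ∂μ ≤ ENNReal.ofReal (4 * r * 2 ^ (r-1) / (r-1)) * ∫⁻ x, F x ^ r ∂μ := by
  have hM := MU_measurable μ F
  have hr0 : 0 < r := by linarith
  have m0 : Measurable (fun l : ℝ => ENNReal.ofReal (l ^ (r-1))) :=
    (measurable_id.pow_const _).ennreal_ofReal
  have m0' : Measurable (fun l : ℝ => ENNReal.ofReal (l ^ (r-1-1))) :=
    (measurable_id.pow_const _).ennreal_ofReal
  have m1 : Measurable (fun z : ℝ × ℝ => if ENNReal.ofReal z.2 < MU μ F z.1 then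
      ENNReal.ofReal (z.2 ^ (r-1)) else 0) :=
    Measurable.ite (measurableSet_lt measurable_snd.ennreal_ofReal (hM.comp measurable_fst))
      (m0.comp measurable_snd) measurable_const
  have m2 : Measurable (fun z : ℝ × ℝ => if ENNReal.ofReal z.1 < 2 * F z.2 then
      F z.2 else 0) :=
    Measurable.ite (measurableSet_lt measurable_fst.ennreal_ofReal
      ((hF.comp measurable_snd).const_mul 2)) (hF.comp measurable_snd) measurable_const
  calc ∫⁻ x, MU μ F x ^ r ∂μ
      ≤ ∫⁻ x, ENNReal.ofReal r * (∫⁻ l in Ioi (0:ℝ),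
      (if ENNReal.ofReal l < MU μ F x then ENNReal.ofReal (l ^ (r - 1)) else 0)) ∂μ :=
        lintegral_mono fun x => layer_ge r hr0 _
    _ = ENNReal.ofReal r * ∫⁻ x, (∫⁻ l in Ioi (0:ℝ),
      (if ENNReal.ofReal l < MU μ F x then ENNReal.ofReal (l ^ (r - 1)) else 0)) ∂μ :=
        lintegral_const_mul' _ _ ENNReal.ofReal_ne_top
    _ = ENNReal.ofReal r * ∫⁻ l in Ioi (0:ℝ), ∫⁻ x,
      (if ENNReal.ofReal l < MU μ F x then ENNReal.ofReal (l ^ (r - 1)) else 0) ∂μ := by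
        rw [lintegral_lintegral_swap]
        exact m1.aemeasurable
    _ = ENNReal.ofReal r * ∫⁻ l in Ioi (0:ℝ), ENNReal.ofReal (l ^ (r - 1)) *
          μ {x | ENNReal.ofReal l < MU μ F x} := by
        congr 2; ext l
        have := lintegral_indicator_const (μ := μ)
          (measurableSet_lt (measurable_const (a := ENNReal.ofReal l)) hM) (ENNReal.ofReal (l^(r-1)))
        rw [← this]
        congr 1; ext x; simp [Set.indicator_apply]
    _ ≤ ENNReal.ofReal r * ∫⁻ l in Ioi (0:ℝ), ENNReal.ofReal 4 * (ENNReal.ofReal (l ^ (r - 1 - 1)) *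
          ∫⁻ x, (if ENNReal.ofReal l < 2 * F x then F x else 0) ∂μ) := by
        gcongr 1
        refine setLIntegral_mono' measurableSet_Ioi fun l hl => ?_
        have hl : 0 < l := hl
        calc _ ≤ ENNReal.ofReal (l ^ (r - 1)) * (ENNReal.ofReal (4 / l) *
              ∫⁻ x, (if ENNReal.ofReal l < 2 * F x then F x else 0) ∂μ) := by
                gcongr; exact MU_trunc μ F hF l hl
          _ = _ := by
                rw [← mul_assoc, ← mul_assoc, ← ENNReal.ofReal_mul (by positivity),
                  ← ENNReal.ofReal_mul (by positivity), Real.rpow_sub_one hl.ne' (r-1)]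
                congr 2; ring
    _ = ENNReal.ofReal r * (ENNReal.ofReal 4 * ∫⁻ l in Ioi (0:ℝ), ∫⁻ x,
          ENNReal.ofReal (l ^ (r - 1 - 1)) * (if ENNReal.ofReal l < 2 * F x then F x else 0) ∂μ) := by
        rw [lintegral_const_mul' _ _ ENNReal.ofReal_ne_top]
        congr 3; ext l
        rw [lintegral_const_mul' _ _ ENNReal.ofReal_ne_top]
    _ = ENNReal.ofReal r * (ENNReal.ofReal 4 * ∫⁻ x, (∫⁻ l in Ioi (0:ℝ),
          ENNReal.ofReal (l ^ (r - 1 - 1)) * (if ENNReal.ofReal l < 2 * F x then F x else 0)) ∂μ) := by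
        rw [lintegral_lintegral_swap]
        exact ((m0'.comp measurable_fst).mul m2).aemeasurable
    _ = ENNReal.ofReal r * (ENNReal.ofReal 4 * ∫⁻ x, F x * (∫⁻ l in Ioi (0:ℝ),
          (if ENNReal.ofReal l < 2 * F x then ENNReal.ofReal (l ^ (r - 1 - 1)) else 0)) ∂μ) := by
        congr 3; ext x
        rw [← lintegral_const_mul]
        · congr 1; ext l; split_ifs <;> ring
        · exact Measurable.ite (measurableSet_lt measurable_id.ennreal_ofReal measurable_const)
            m0' measurable_const
    _ ≤ ENNReal.ofReal r * (ENNReal.ofReal 4 * ∫⁻ x, ENNReal.ofReal (2 ^ (r-1) / (r-1)) * F x ^ r ∂μ) := by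
        refine mul_le_mul_right (mul_le_mul_right (lintegral_mono fun x => ?_) _) _
        calc _ ≤ F x * (ENNReal.ofReal (1/(r-1)) * (2 * F x) ^ (r-1)) := by
              gcongr; exact layer_le (r-1) (by linarith) _
          _ = _ := by
              rw [ENNReal.mul_rpow_of_nonneg _ _ (by linarith : 0 ≤ r-1)]
              have h2 : (2:ℝ≥0∞) ^ (r-1) = ENNReal.ofReal (2 ^ (r-1)) := by
                rw [← ENNReal.ofReal_rpow_of_pos (by norm_num)]; simp
              have h3 : F x ^ r = F x * F x ^ (r-1) := by
                conv_lhs => rw [show r = 1 + (r-1) by ring]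
                rw [ENNReal.rpow_add_of_nonneg _ _ (by norm_num) (by linarith), ENNReal.rpow_one]
              rw [h2, h3, div_eq_mul_one_div ((2:ℝ) ^ (r-1)) (r-1), ENNReal.ofReal_mul (by positivity)]
              ring
    _ = _ := by
        rw [lintegral_const_mul' _ _ ENNReal.ofReal_ne_top, ← mul_assoc, ← mul_assoc,
          ← ENNReal.ofReal_mul (by positivity), ← ENNReal.ofReal_mul (by positivity)]
        congr 2; ring

lemma kernel_bound (α : ℝ) (hα : 0 < α) (hα1 : α < 1) : ∃ C : ℝ, 0 < C ∧
    ∀ (ν : Measure ℝ) (t : ℝ) (P : ℝ≥0∞), ν univ ≠ 0 → ν univ ≠ ∞ →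
    (∀ d : ℝ, 0 < d → ν (Ioc (t + d) (t + 2 * d)) ≤ ENNReal.ofReal d * P) →
    ∫⁻ x in Ioi t, ENNReal.ofReal ((x - t) ^ (α - 1)) ∂ν ≤
      ENNReal.ofReal C * (ν univ) ^ α * P ^ (1 - α) := by
  have hsum : Summable (fun k : ℕ => ((2:ℝ) ^ (-α)) ^ (k+1)) :=
    (summable_nat_add_iff 1).mpr (summable_geometric_of_lt_one (by positivity)
      (Real.rpow_lt_one_of_one_lt_of_neg (by norm_num) (by linarith)))
  set S := ∑' k : ℕ, ((2:ℝ) ^ (-α)) ^ (k+1) with hS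
  have hS0 : 0 ≤ S := tsum_nonneg fun k => by positivity
  refine ⟨S + 1, by positivity, ?_⟩
  intro ν t P hv0 hvt hP
  set v := ν univ with hv
  -- basic bound
  have basic : ∀ h : ℝ, 0 < h → ∫⁻ x in Ioi t, ENNReal.ofReal ((x - t) ^ (α - 1)) ∂ν ≤
      ENNReal.ofReal (S * h ^ α) * P + ENNReal.ofReal (h ^ (α - 1)) * v := by
    intro h hh
    have hcov : Ioi t ⊆ (⋃ k : ℕ, Ioc (t + h / 2 ^ (k+1)) (t + 2 * (h / 2^(k+1)))) ∪ Ioi (t + h) := by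
      intro x hx
      have hx : t < x := hx
      by_cases hxh : t + h < x
      · exact Or.inr hxh
      · left
        push Not at hxh
        -- find k
        have hex : ∃ k : ℕ, h / 2 ^ (k+1) < x - t := by
          have : Tendsto (fun k : ℕ => h * (1/2:ℝ) ^ (k+1)) atTop (nhds (h * 0)) :=
            ((tendsto_pow_atTop_nhds_zero_of_lt_one (by norm_num) (by norm_num)).comp
              (tendsto_add_atTop_nat 1)).const_mul h
          rw [mul_zero] at this
          obtain ⟨k, hk⟩ := (this.eventually (gt_mem_nhds (show 0 < x - t by linarith))).exists
          exact ⟨k, by simpa [div_eq_mul_inv] using hk⟩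
        classical
        refine mem_iUnion.mpr ⟨Nat.find hex, ?_, ?_⟩
        · have := Nat.find_spec hex; linarith
        · rcases Nat.eq_zero_or_pos (Nat.find hex) with h0 | h0
          · rw [h0]; norm_num; linarith
          · have := Nat.find_min hex (m := Nat.find hex - 1) (by omega)
            rw [Nat.sub_add_cancel h0] at this
            push Not at this
            rw [pow_succ]
            have e : ∀ n : ℕ, 2 * (h / ((2:ℝ) ^ n * 2)) = h / 2 ^ n := fun n => by field_simp
            rw [e]; linarith
    calc ∫⁻ x in Ioi t, ENNReal.ofReal ((x - t) ^ (α - 1)) ∂ν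
        ≤ ∫⁻ x in (⋃ k : ℕ, Ioc (t + h / 2 ^ (k+1)) (t + 2 * (h / 2^(k+1)))) ∪ Ioi (t + h),
            ENNReal.ofReal ((x - t) ^ (α - 1)) ∂ν := lintegral_mono_set hcov
      _ ≤ ∫⁻ x in (⋃ k : ℕ, Ioc (t + h / 2 ^ (k+1)) (t + 2 * (h / 2^(k+1)))),
            ENNReal.ofReal ((x - t) ^ (α - 1)) ∂ν + ∫⁻ x in Ioi (t + h),
            ENNReal.ofReal ((x - t) ^ (α - 1)) ∂ν := lintegral_union_le _ _ _
      _ ≤ ∑' k : ℕ, ∫⁻ x in Ioc (t + h / 2 ^ (k+1)) (t + 2 * (h / 2^(k+1))),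
            ENNReal.ofReal ((x - t) ^ (α - 1)) ∂ν + ∫⁻ x in Ioi (t + h),
            ENNReal.ofReal ((x - t) ^ (α - 1)) ∂ν := by
          gcongr; exact lintegral_iUnion_le _ _
      _ ≤ ∑' k : ℕ, ENNReal.ofReal (h ^ α * ((2:ℝ) ^ (-α)) ^ (k+1)) * P
            + ENNReal.ofReal (h ^ (α - 1)) * v := by
          gcongr with k
          · set d := h / 2 ^ (k+1) with hd
            have hd0 : 0 < d := by positivity
            calc _ ≤ ∫⁻ x in Ioc (t + d) (t + 2 * d), ENNReal.ofReal (d ^ (α-1)) ∂ν := by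
                  refine setLIntegral_mono' measurableSet_Ioc fun x hx => ?_
                  refine ENNReal.ofReal_le_ofReal ?_
                  exact Real.rpow_le_rpow_of_nonpos hd0 (by linarith [hx.1]) (by linarith)
              _ = ENNReal.ofReal (d ^ (α-1)) * ν (Ioc (t + d) (t + 2 * d)) := by
                  rw [setLIntegral_const]
              _ ≤ ENNReal.ofReal (d ^ (α-1)) * (ENNReal.ofReal d * P) := by
                  gcongr; exact hP d hd0
              _ = _ := by
                  rw [← mul_assoc, ← ENNReal.ofReal_mul (by positivity)]
                  congr 2
                  rw [Real.rpow_sub_one hd0.ne', div_mul_cancel₀ _ hd0.ne', hd,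
                    Real.div_rpow hh.le (by positivity), ← Real.rpow_natCast, ← Real.rpow_natCast,
                    ← Real.rpow_mul (by norm_num), ← Real.rpow_mul (by norm_num),
                    div_eq_mul_inv, ← Real.rpow_neg (by norm_num)]
                  congr 2; ring
          · calc _ ≤ ∫⁻ x in Ioi (t + h), ENNReal.ofReal (h ^ (α-1)) ∂ν := by
                  refine setLIntegral_mono' measurableSet_Ioi fun x hx => ?_
                  refine ENNReal.ofReal_le_ofReal ?_
                  have hx : t + h < x := hx
                  exact Real.rpow_le_rpow_of_nonpos hh (by linarith) (by linarith)
              _ = ENNReal.ofReal (h ^ (α-1)) * ν (Ioi (t + h)) := by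
                  rw [setLIntegral_const]
              _ ≤ _ := by gcongr; exact measure_mono (subset_univ _)
      _ = _ := by
          rw [ENNReal.tsum_mul_right, ← ENNReal.ofReal_tsum_of_nonneg (fun k => by positivity)
            (hsum.mul_left _), tsum_mul_left, mul_comm S]
  by_cases hPt : P = ∞
  · subst hPt
    rw [ENNReal.top_rpow_of_pos (by linarith), ENNReal.mul_top]
    · exact le_top
    · refine mul_ne_zero (by simp; linarith) ?_
      simp only [ne_eq, ENNReal.rpow_eq_zero_iff]
      push Not
      exact ⟨fun h => absurd h hv0, fun h => absurd h hvt⟩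
  by_cases hP0 : P = 0
  · subst hP0
    have hlim : Tendsto (fun h : ℝ => ENNReal.ofReal (h ^ (α - 1)) * v) atTop (nhds (ENNReal.ofReal 0 * v)) := by
      refine ENNReal.Tendsto.mul_const ?_ (Or.inr hvt)
      refine ENNReal.tendsto_ofReal ?_
      have := tendsto_rpow_neg_atTop (y := 1 - α) (by linarith)
      simpa using this
    refine le_trans (ge_of_tendsto hlim ?_) (by simp)
    filter_upwards [eventually_gt_atTop 0] with h hh
    simpa using basic h hh
  · have hPr : 0 < P.toReal := ENNReal.toReal_pos hP0 hPt
    have hvr : 0 < v.toReal := ENNReal.toReal_pos hv0 hvt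
    refine (basic (v.toReal / P.toReal) (by positivity)).trans (le_of_eq ?_)
    set a := v.toReal
    set b := P.toReal
    have hva : v = ENNReal.ofReal a := (ENNReal.ofReal_toReal hvt).symm
    have hPb : P = ENNReal.ofReal b := (ENNReal.ofReal_toReal hPt).symm
    rw [hva, hPb, ENNReal.ofReal_rpow_of_pos hvr, ENNReal.ofReal_rpow_of_pos hPr,
      ← ENNReal.ofReal_mul (by positivity), ← ENNReal.ofReal_mul (by positivity),
      ← ENNReal.ofReal_mul (by positivity), ← ENNReal.ofReal_mul (by positivity),
      ← ENNReal.ofReal_add (by positivity) (by positivity)]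
    congr 1
    rw [Real.rpow_sub_one (by positivity), Real.div_rpow hvr.le hPr.le, Real.rpow_sub hPr,
      Real.rpow_one]
    field_simp

lemma shift_bound (σ : ℝ → ℝ≥0∞)
    (hfin : ∀ a b, (volume.withDensity σ) (Ioo a b) ≠ ∞)
    (F : ℝ → ℝ≥0∞) (t b : ℝ) (htb : t < b) (h0 : (volume.withDensity σ) (Ioo t b) ≠ 0) :
    ∫⁻ x in Ioo t b, F x ∂(volume.withDensity σ) ≤
      2 * (volume.withDensity σ) (Ioo t b) * MU (volume.withDensity σ) F t := by
  set m := volume.withDensity σ with hm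
  have hX := hfin t b
  have hf : ∫⁻ x, σ x ∂(volume.restrict (Ioo (t-1) b)) ≠ ∞ := by
    have := hfin (t-1) b
    rwa [withDensity_apply _ measurableSet_Ioo] at this
  obtain ⟨δ, hδ, hδ'⟩ := exists_pos_setLIntegral_lt_of_measure_lt hf h0
  obtain ⟨ε, hε0, hε1, hεδ⟩ : ∃ ε : ℝ, 0 < ε ∧ ε < 1 ∧ ENNReal.ofReal ε < δ := by
    by_cases hd : δ = ∞
    · exact ⟨1/2, by norm_num, by norm_num, by simp [hd]⟩
    · have hdp := ENNReal.toReal_pos hδ.ne' hd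
      refine ⟨min (1/2) (δ.toReal/2), by positivity, ?_, ?_⟩
      · exact lt_of_le_of_lt (min_le_left _ _) (by norm_num)
      · rw [ENNReal.ofReal_lt_iff_lt_toReal (by positivity) hd]
        exact lt_of_le_of_lt (min_le_right _ _) (by linarith)
  have hsmall : m (Ioc (t-ε) t) ≤ m (Ioo t b) := by
    have := hδ' (Ioc (t-ε) t) (by
      refine lt_of_le_of_lt (Measure.restrict_apply_le _ _) ?_
      rw [Real.volume_Ioc]; simpa using hεδ)
    rw [Measure.restrict_restrict measurableSet_Ioc, inter_eq_left.mpr] at this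
    · rw [hm, withDensity_apply _ measurableSet_Ioc]; exact this.le
    · intro x hx; exact ⟨by linarith [hx.1], by linarith [hx.2]⟩
  have h2X : m (Ioo (t-ε) b) ≤ 2 * m (Ioo t b) := by
    calc m (Ioo (t-ε) b) ≤ m (Ioc (t-ε) t ∪ Ioo t b) := by
          apply measure_mono
          intro x hx
          rcases le_or_gt x t with h | h
          · exact Or.inl ⟨hx.1, h⟩
          · exact Or.inr ⟨h, hx.2⟩
      _ ≤ m (Ioc (t-ε) t) + m (Ioo t b) := measure_union_le _ _
      _ ≤ m (Ioo t b) + m (Ioo t b) := by gcongr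
      _ = _ := by ring
  have hY := hfin (t-ε) b
  have hY0 : m (Ioo (t-ε) b) ≠ 0 := by
    intro h
    exact h0 (measure_mono_null (Ioo_subset_Ioo_left (by linarith)) h)
  have hMU : (∫⁻ x in Ioo (t-ε) b, F x ∂m) / m (Ioo (t-ε) b) ≤ MU m F t :=
    le_iSup₂ (f := fun (i : ℝ × ℝ) (_ : t ∈ Ioo i.1 i.2) =>
              (∫⁻ x in Ioo i.1 i.2, F x ∂m) / m (Ioo i.1 i.2)) (t-ε, b) ⟨by simpa using hε0, htb⟩
  calc _ ≤ ∫⁻ x in Ioo (t-ε) b, F x ∂m := lintegral_mono_set (Ioo_subset_Ioo_left (by linarith))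
    _ ≤ MU m F t * m (Ioo (t-ε) b) := by
        rwa [ENNReal.div_le_iff hY0 hY] at hMU
    _ ≤ MU m F t * (2 * m (Ioo t b)) := by gcongr
    _ = _ := by ring

lemma exists_scale (U : ℕ → ℝ≥0∞) (B : ℝ≥0∞) (hB : B ≠ ∞) (hUB : ∀ n, U n ≤ B) (h0 : U 0 ≠ 0) :
    ∃ k, U (k+1) ≤ 2 * U k ∧ (∀ j, k = j + 1 → 2 * U j < U k) := by
  classical
  have hex : ∃ k, U (k+1) ≤ 2 * U k := by
    by_contra hc
    push Not at hc
    have hpow : ∀ n : ℕ, (n : ℝ≥0∞) * U 0 ≤ U n := by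
      intro n
      have : (2:ℝ≥0∞) ^ n * U 0 ≤ U n := by
        induction n with
        | zero => simp
        | succ n ih =>
          calc _ = 2 * (2 ^ n * U 0) := by ring
            _ ≤ 2 * U n := by gcongr
            _ ≤ _ := (hc n).le
      refine le_trans ?_ this
      gcongr
      exact_mod_cast (Nat.lt_two_pow_self).le
    obtain ⟨n, hn⟩ := ENNReal.exists_nat_mul_gt h0 hB
    exact absurd ((hpow n).trans (hUB n)) (not_le.mpr hn)
  refine ⟨Nat.find hex, Nat.find_spec hex, fun j hj => ?_⟩
  have := Nat.find_min hex (m := j) (by omega)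
  push Not at this
  rwa [hj]

lemma pointwise_bound (u σ : ℝ → ℝ≥0∞) (hu : Measurable u) (hσ : Measurable σ)
    (hσ0 : ∀ x, σ x ≠ 0) (hσt : ∀ x, σ x ≠ ∞) (r s : ℝ) (hr : 1 < r) (hs : 1 < s)
    (hrs : (r - 1) * (s - 1) = 1) (K : ℝ≥0∞)
    (hUf : ∀ a b, (volume.withDensity u) (Ioo a b) ≠ ∞)
    (hU0 : ∀ a b, a < b → (volume.withDensity u) (Ioo a b) ≠ 0)
    (hSf : ∀ a b, (volume.withDensity σ) (Ioo a b) ≠ ∞)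
    (hS0 : ∀ a b, a < b → (volume.withDensity σ) (Ioo a b) ≠ 0)
    (hK : ∀ x d : ℝ, 0 < d → (volume.withDensity u) (Ioo x (x+d)) *
      (volume.withDensity σ) (Ioo (x-d) x) ^ (r-1) ≤ K * ENNReal.ofReal d ^ r)
    (E : Set ℝ) (hE : MeasurableSet E) (t d0 : ℝ) (hd0 : 0 < d0) :
    (volume.withDensity u) (E ∩ Ioo (t + d0) (t + 2 * d0)) ≤ ENNReal.ofReal d0 *
      ((4:ℝ≥0∞) ^ r * K * MU (volume.withDensity σ)
        (fun y => MU (volume.withDensity u) (E.indicator 1) y ^ (s-1) * (σ y)⁻¹) t ^ (r-1)) := by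
  set mu := volume.withDensity u with hmu
  set ms := volume.withDensity σ with hms
  set N := MU mu (E.indicator 1) with hN
  set F : ℝ → ℝ≥0∞ := fun y => N y ^ (s-1) * (σ y)⁻¹ with hF
  set b := t + 2 * d0 with hb
  set D := mu (E ∩ Ioo (t + d0) b) with hD
  have hs1 : 0 < s - 1 := by linarith
  have hr1 : 0 < r - 1 := by linarith
  obtain ⟨k, hk1, hk2⟩ := exists_scale (fun n => mu (Ioo (t + d0 / 2 ^ n) b)) (mu (Ioo t b)) (hUf _ _)
    (fun n => measure_mono (Ioo_subset_Ioo_left (by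
      have : 0 < d0 / 2 ^ n := by positivity
      linarith))) (hU0 _ _ (by simp [hb]; linarith))
  set d := d0 / 2 ^ k with hd
  have hdp : 0 < d := by positivity
  have hdd0 : d ≤ d0 := div_le_self hd0.le (one_le_pow₀ (by norm_num))
  have hdhalf : d0 / 2 ^ (k+1) = d / 2 := by rw [hd, pow_succ]; field_simp
  rw [hdhalf] at hk1
  set V := mu (Ioo (t + d) b) with hV
  have hV0 : V ≠ 0 := hU0 _ _ (by simp [hb]; linarith)
  have hVt : V ≠ ∞ := hUf _ _
  have hVle : V ≤ 2 * mu (Ioo (t + d) (t + d + d)) := by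
    rcases Nat.eq_zero_or_pos k with h0 | h0
    · have : d = d0 := by rw [hd, h0]; simp
      rw [hV, hb, this, show t + d0 + d0 = t + 2 * d0 by ring]
      exact le_mul_of_one_le_left' (by norm_num)
    · obtain ⟨j, hj⟩ := Nat.exists_eq_add_of_le' h0
      have h2 := hk2 j hj
      have hdj : d0 / 2 ^ j = d + d := by
        rw [hd, hj, pow_succ]; field_simp; norm_num
      rw [hdj, ← add_assoc] at h2
      set V' := mu (Ioo (t + d + d) b)
      have hsplit : V ≤ mu (Ioo (t + d) (t + d + d)) + V' := by
        calc V ≤ mu (Ioc (t+d) (t+d+d) ∪ Ioo (t+d+d) b) := by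
              apply measure_mono
              intro x hx
              rcases le_or_gt x (t+d+d) with h | h
              · exact Or.inl ⟨hx.1, h⟩
              · exact Or.inr ⟨h, hx.2⟩
          _ ≤ mu (Ioc (t+d) (t+d+d)) + V' := measure_union_le _ _
          _ = _ := by rw [measure_congr (Ioo_ae_eq_Ioc (μ := mu))]
      have hV't : V' ≠ ∞ := hUf _ _
      have : V + V ≤ 2 * mu (Ioo (t + d) (t + d + d)) + V := by
        calc V + V ≤ (mu (Ioo (t + d) (t + d + d)) + V') + (mu (Ioo (t + d) (t + d + d)) + V') := by
              gcongr
          _ = 2 * mu (Ioo (t + d) (t + d + d)) + 2 * V' := by ring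
          _ ≤ _ := by gcongr
      exact (ENNReal.add_le_add_iff_right hVt).mp this
  set X := ms (Ioo t (t + d)) with hX
  have hX1 : V * X ^ (r-1) ≤ 2 * K * ENNReal.ofReal d ^ r := by
    have := hK (t+d) d hdp
    rw [add_sub_cancel_right] at this
    calc V * X ^ (r-1) ≤ (2 * mu (Ioo (t + d) (t + d + d))) * X ^ (r-1) := by gcongr
      _ = 2 * (mu (Ioo (t + d) (t + d + d)) * X ^ (r-1)) := by ring
      _ ≤ 2 * (K * ENNReal.ofReal d ^ r) := by gcongr
      _ = _ := by ring
  set dd := ENNReal.ofReal d with hdd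
  have hdd0' : dd ≠ 0 := by simpa [hdd] using hdp
  have hddt : dd ≠ ∞ := ENNReal.ofReal_ne_top
  have h1 : V ^ (s-1) * X ≤ (2:ℝ≥0∞) ^ (s-1) * K ^ (s-1) * (dd * dd ^ (s-1)) := by
    have := ENNReal.rpow_le_rpow hX1 hs1.le
    rw [ENNReal.mul_rpow_of_nonneg _ _ hs1.le, ENNReal.mul_rpow_of_nonneg _ _ hs1.le,
      ENNReal.mul_rpow_of_nonneg _ _ hs1.le, ← ENNReal.rpow_mul, hrs, ENNReal.rpow_one,
      ← ENNReal.rpow_mul, show r * (s-1) = 1 + (s - 1) by linarith,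
      ENNReal.rpow_add _ _ hdd0' hddt, ENNReal.rpow_one] at this
    exact this
  set c1 := MU ms F t with hc1
  have hNlow : ∀ y ∈ Ioo (t + d/2) (t + d), D / (2 * V) ≤ N y := by
    intro y hy
    have hyb : y < b := by simp only [hb]; linarith [hy.2]
    have := le_iSup₂ (f := fun (i : ℝ × ℝ) (_ : y ∈ Ioo i.1 i.2) =>
              (∫⁻ x in Ioo i.1 i.2, E.indicator 1 x ∂mu) / mu (Ioo i.1 i.2)) (t+d/2, b) ⟨hy.1, hyb⟩
    refine le_trans ?_ this
    simp only
    rw [lintegral_indicator_one hE, Measure.restrict_apply hE]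
    exact ENNReal.div_le_div (measure_mono (inter_subset_inter_right _
      (Ioo_subset_Ioo_left (by linarith)))) hk1
  have h2 : dd / 2 * (D / (2 * V)) ^ (s-1) ≤ 2 * X * c1 := by
    refine le_trans ?_ (shift_bound σ hSf F t (t+d) (by linarith) (hS0 _ _ (by linarith)))
    have hNm : Measurable N := MU_measurable _ _
    have hFm : Measurable F := (hNm.pow_const _).mul hσ.inv
    rw [setLIntegral_withDensity_eq_setLIntegral_mul _ hσ hFm measurableSet_Ioo]
    calc dd / 2 * (D / (2 * V)) ^ (s-1)
        = ∫⁻ x in Ioo (t + d/2) (t+d), (D / (2 * V)) ^ (s-1) := by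
          rw [setLIntegral_const, Real.volume_Ioo, mul_comm]
          congr 1
          rw [show t + d - (t + d/2) = d / 2 by ring, ENNReal.ofReal_div_of_pos (by norm_num)]
          simp [hdd]
      _ ≤ ∫⁻ x in Ioo (t + d/2) (t+d), (σ * F) x := by
          refine setLIntegral_mono' measurableSet_Ioo fun y hy => ?_
          have e : (σ * F) y = N y ^ (s-1) := by
            simp only [Pi.mul_apply, hF]
            rw [mul_comm (N y ^ (s-1)), ← mul_assoc, ENNReal.mul_inv_cancel (hσ0 y) (hσt y), one_mul]
          rw [e]
          exact ENNReal.rpow_le_rpow (hNlow y hy) hs1.le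
      _ ≤ _ := lintegral_mono_set (Ioo_subset_Ioo_left (by linarith))
  have h3 : D ^ (s-1) ≤ 4 * (4:ℝ≥0∞) ^ (s-1) * K ^ (s-1) * dd ^ (s-1) * c1 := by
    have h2V0 : 2 * V ≠ 0 := mul_ne_zero (by norm_num) hV0
    have h2Vt : 2 * V ≠ ∞ := ENNReal.mul_ne_top (by norm_num) hVt
    have hDV : (D / (2 * V)) ^ (s-1) * ((2:ℝ≥0∞) ^ (s-1) * V ^ (s-1)) = D ^ (s-1) := by
      rw [← ENNReal.mul_rpow_of_nonneg _ _ hs1.le, ← ENNReal.mul_rpow_of_nonneg _ _ hs1.le,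
        ENNReal.div_mul_cancel h2V0 h2Vt]
    have h4 : dd / 2 * D ^ (s-1) ≤ dd / 2 * (4 * (4:ℝ≥0∞) ^ (s-1) * K ^ (s-1) * dd ^ (s-1) * c1) := by
      calc dd / 2 * D ^ (s-1)
          = dd / 2 * (D / (2 * V)) ^ (s-1) * ((2:ℝ≥0∞) ^ (s-1) * V ^ (s-1)) := by rw [← hDV]; ring
        _ ≤ (2 * X * c1) * ((2:ℝ≥0∞) ^ (s-1) * V ^ (s-1)) := by gcongr
        _ = 2 * c1 * (2:ℝ≥0∞) ^ (s-1) * (V ^ (s-1) * X) := by ring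
        _ ≤ 2 * c1 * (2:ℝ≥0∞) ^ (s-1) * ((2:ℝ≥0∞) ^ (s-1) * K ^ (s-1) * (dd * dd ^ (s-1))) := by
            gcongr
        _ = _ := by
            have e4 : (4:ℝ≥0∞) ^ (s-1) = (2:ℝ≥0∞) ^ (s-1) * (2:ℝ≥0∞) ^ (s-1) := by
              rw [← ENNReal.mul_rpow_of_nonneg _ _ hs1.le]; norm_num
            have ed : dd = dd / 2 * 2 := (ENNReal.div_mul_cancel (by norm_num) (by norm_num)).symm
            rw [e4]
            conv_lhs => rw [show dd * dd ^ (s-1) = (dd / 2 * 2) * dd ^ (s-1) by rw [← ed]]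
            ring
    refine (ENNReal.mul_le_mul_iff_right ?_ ?_).mp h4
    · exact (ENNReal.div_pos hdd0' (by norm_num)).ne'
    · exact ENNReal.div_ne_top hddt (by norm_num)
  have h5 := ENNReal.rpow_le_rpow h3 hr1.le
  have hsr : (s-1) * (r-1) = 1 := by linarith
  have e44 : (4 * (4:ℝ≥0∞) ^ (s-1)) ^ (r-1) = (4:ℝ≥0∞) ^ r := by
    rw [ENNReal.mul_rpow_of_nonneg _ _ hr1.le, ← ENNReal.rpow_mul, hsr,
      ← ENNReal.rpow_add _ _ (by norm_num) (by norm_num)]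
    congr 1; ring
  rw [ENNReal.mul_rpow_of_nonneg _ _ hr1.le, ENNReal.mul_rpow_of_nonneg _ _ hr1.le,
    ENNReal.mul_rpow_of_nonneg _ _ hr1.le, e44, ← ENNReal.rpow_mul, ← ENNReal.rpow_mul,
    ← ENNReal.rpow_mul, hsr, ENNReal.rpow_one, ENNReal.rpow_one, ENNReal.rpow_one] at h5
  calc D ≤ (4:ℝ≥0∞) ^ r * K * dd * c1 ^ (r-1) := h5
    _ ≤ (4:ℝ≥0∞) ^ r * K * ENNReal.ofReal d0 * c1 ^ (r-1) := by
        gcongr; exact ENNReal.ofReal_le_ofReal hdd0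
    _ = _ := by ring

theorem core_bound (p q α p' r s : ℝ) (hα : 0 < α) (hα1 : α < 1) (hpp : p.HolderConjugate p')
    (hq : 0 < q) (hr : r = 1 + q / p') (hs : s = 1 + p' / q) (hrel : 1 / q + 1 / p' = 1 - α) :
    ∃ c : ℝ, 0 < c ∧
    ∀ (W : ℝ → ℝ≥0∞), Measurable W → (∀ x, W x ≠ 0) → (∀ x, W x ≠ ∞) → ∀ K : ℝ≥0∞,
    (∀ a b, (volume.withDensity (fun x => W x ^ q)) (Ioo a b) ≠ ∞) →
    (∀ a b, a < b → (volume.withDensity (fun x => W x ^ q)) (Ioo a b) ≠ 0) →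
    (∀ a b, (volume.withDensity (fun x => W x ^ (-p'))) (Ioo a b) ≠ ∞) →
    (∀ a b, a < b → (volume.withDensity (fun x => W x ^ (-p'))) (Ioo a b) ≠ 0) →
    (∀ x d : ℝ, 0 < d → (volume.withDensity (fun x => W x ^ q)) (Ioo x (x+d)) *
      (volume.withDensity (fun x => W x ^ (-p'))) (Ioo (x-d) x) ^ (r-1) ≤ K * ENNReal.ofReal d ^ r) →
    ∀ (g : ℝ → ℝ≥0∞), Measurable g → ∀ (E : Set ℝ), MeasurableSet E →
    (volume.withDensity (fun x => W x ^ q)) E ≠ ∞ → ∀ l : ℝ≥0∞,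
    (∀ x ∈ E, l ≤ ∫⁻ t in Iio x, g t * ENNReal.ofReal ((x - t) ^ (α - 1))) →
    l * (volume.withDensity (fun x => W x ^ q)) E ^ (1 / q) ≤
      ENNReal.ofReal c * K ^ (1 - α) * (∫⁻ t, (g t * W t) ^ p) ^ (1 / p) := by
  obtain ⟨C, hC, hker⟩ := kernel_bound α hα hα1
  have hp'0 : 0 < p' := hpp.symm.pos
  have hr1 : 1 < r := by rw [hr]; have : 0 < q / p' := by positivity
                         linarith
  have hs1 : 1 < s := by rw [hs]; have : 0 < p' / q := by positivity
                         linarith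
  have hrs : (r - 1) * (s - 1) = 1 := by rw [hr, hs]; field_simp; ring
  set Cr : ℝ := 4 * r * 2 ^ (r-1) / (r-1) with hCr
  set Cs : ℝ := 4 * s * 2 ^ (s-1) / (s-1) with hCs
  have hCr0 : 0 < Cr := by have : 0 < r - 1 := by linarith
                           positivity
  have hCs0 : 0 < Cs := by have : 0 < s - 1 := by linarith
                           positivity
  refine ⟨C * (((4:ℝ) ^ r) ^ s * Cr * Cs) ^ (1 / p'), by positivity, ?_⟩
  intro W hW hW0 hWt K hUf hU0 hSf hS0 hK g hg E hE hEf l hl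
  set u : ℝ → ℝ≥0∞ := fun x => W x ^ q with hu
  set σ : ℝ → ℝ≥0∞ := fun x => W x ^ (-p') with hσ
  have hum : Measurable u := hW.pow_const _
  have hσm : Measurable σ := hW.pow_const _
  have hσ0 : ∀ x, σ x ≠ 0 := fun x => (ENNReal.rpow_pos (hW0 x).bot_lt (hWt x)).ne'
  have hσt : ∀ x, σ x ≠ ∞ := fun x => ENNReal.rpow_ne_top_of_ne_zero (hW0 x) (hWt x)
  set mu := volume.withDensity u with hmu
  set ms := volume.withDensity σ with hms
  set v := mu E with hv
  by_cases hv0 : v = 0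
  · rw [hv0, ENNReal.zero_rpow_of_pos (by positivity), mul_zero]; exact zero_le
  set N := MU mu (E.indicator 1) with hN
  set F : ℝ → ℝ≥0∞ := fun y => N y ^ (s-1) * (σ y)⁻¹ with hF
  have hNm : Measurable N := MU_measurable _ _
  have hFm : Measurable F := (hNm.pow_const _).mul hσm.inv
  set P : ℝ → ℝ≥0∞ := fun t => (4:ℝ≥0∞) ^ r * K * MU ms F t ^ (r-1) with hP
  have hPm : Measurable P := ((MU_measurable _ _).pow_const _).const_mul _
  have B1 : ∀ t, ∫⁻ x in Ioi t, ENNReal.ofReal ((x - t) ^ (α - 1)) ∂(mu.restrict E) ≤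
      ENNReal.ofReal C * v ^ α * P t ^ (1 - α) := by
    intro t
    have := hker (mu.restrict E) t (P t) (by simpa using hv0) (by simpa using hEf) ?_
    · simpa using this
    · intro d hd
      rw [Measure.restrict_apply measurableSet_Ioc, inter_comm]
      rw [measure_congr ((ae_eq_refl E).inter (Ioo_ae_eq_Ioc (μ := mu)).symm)]
      exact pointwise_bound u σ hum hσm hσ0 hσt r s hr1 hs1 hrs K hUf hU0 hSf hS0 hK E hE t d hd
  have hker_m : Measurable (fun z : ℝ × ℝ => ENNReal.ofReal ((z.1 - z.2) ^ (α - 1))) :=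
    ((measurable_fst.sub measurable_snd).pow_const _).ennreal_ofReal
  have B2 : l * v ≤ ENNReal.ofReal C * v ^ α * ∫⁻ t, (g t * W t) * ((W t)⁻¹ * P t ^ (1-α)) := by
    calc l * v = ∫⁻ x in E, l ∂mu := by rw [setLIntegral_const]
      _ ≤ ∫⁻ x in E, (∫⁻ t, (if t < x then g t * ENNReal.ofReal ((x - t) ^ (α - 1)) else 0)) ∂mu := by
          refine setLIntegral_mono' hE fun x hx => ?_
          refine (hl x hx).trans (le_of_eq ?_)
          rw [← lintegral_indicator measurableSet_Iio]
          congr 1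
      _ = ∫⁻ t, ∫⁻ x in E, (if t < x then g t * ENNReal.ofReal ((x - t) ^ (α - 1)) else 0) ∂mu := by
          rw [lintegral_lintegral_swap]
          refine Measurable.aemeasurable ?_
          exact Measurable.ite (measurableSet_lt measurable_snd measurable_fst)
            ((hg.comp measurable_snd).mul hker_m) measurable_const
      _ ≤ ∫⁻ t, g t * (ENNReal.ofReal C * v ^ α * P t ^ (1 - α)) := by
          refine lintegral_mono fun t => ?_
          calc _ = ∫⁻ x in E, g t * (Ioi t).indicator (fun x => ENNReal.ofReal ((x - t) ^ (α - 1))) x ∂mu := by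
                congr 1; ext x
                by_cases h : t < x <;> simp [h]
            _ = g t * ∫⁻ x in Ioi t, ENNReal.ofReal ((x - t) ^ (α - 1)) ∂(mu.restrict E) := by
                rw [lintegral_const_mul, lintegral_indicator measurableSet_Ioi]
                exact (((measurable_id.sub_const t).pow_const _).ennreal_ofReal).indicator
                  measurableSet_Ioi
            _ ≤ _ := by gcongr; exact B1 t
      _ = ∫⁻ t, (ENNReal.ofReal C * v ^ α) * ((g t * W t) * ((W t)⁻¹ * P t ^ (1-α))) := by
          congr 1; ext t
          have : W t * (W t)⁻¹ = 1 := ENNReal.mul_inv_cancel (hW0 t) (hWt t)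
          calc _ = (ENNReal.ofReal C * v ^ α) * (g t * (W t * (W t)⁻¹) * P t ^ (1-α)) := by
                rw [this]; ring
            _ = _ := by ring
      _ = _ := lintegral_const_mul' _ _ (ENNReal.mul_ne_top ENNReal.ofReal_ne_top
          (ENNReal.rpow_ne_top_of_nonneg hα.le hEf))
  have B3 : ∫⁻ t, ((W t)⁻¹ * P t ^ (1-α)) ^ p' ≤
      ((4:ℝ≥0∞) ^ r * K) ^ s * (ENNReal.ofReal Cr * (ENNReal.ofReal Cs * v)) := by
    calc ∫⁻ t, ((W t)⁻¹ * P t ^ (1-α)) ^ p'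
        = ∫⁻ t, ((4:ℝ≥0∞) ^ r * K) ^ s * (σ t * MU ms F t ^ r) := by
          congr 1; ext t
          rw [ENNReal.mul_rpow_of_nonneg _ _ hp'0.le, ← ENNReal.rpow_mul,
            show (1 - α) * p' = s by rw [← hrel, hs]; field_simp; ring,
            ENNReal.mul_rpow_of_nonneg _ _ (by linarith : 0 ≤ s), ← ENNReal.rpow_mul,
            show (r-1) * s = r by linarith, ENNReal.inv_rpow, ← ENNReal.rpow_neg]
          ring
      _ = ((4:ℝ≥0∞) ^ r * K) ^ s * ∫⁻ t, MU ms F t ^ r ∂ms := by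
          have hm : Measurable (fun t => MU ms F t ^ r) := (MU_measurable _ _).pow_const _
          have e : ∫⁻ t, MU ms F t ^ r ∂ms = ∫⁻ t, σ t * MU ms F t ^ r :=
            lintegral_withDensity_eq_lintegral_mul _ hσm hm
          rw [e, lintegral_const_mul]
          exact hσm.mul hm
      _ ≤ ((4:ℝ≥0∞) ^ r * K) ^ s * (ENNReal.ofReal Cr * ∫⁻ t, F t ^ r ∂ms) := by
          gcongr; exact MU_strong ms F hFm r hr1
      _ = ((4:ℝ≥0∞) ^ r * K) ^ s * (ENNReal.ofReal Cr * ∫⁻ t, N t ^ s ∂mu) := by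
          congr 2
          rw [hms, hmu, lintegral_withDensity_eq_lintegral_mul _ hσm (hFm.pow_const _),
            lintegral_withDensity_eq_lintegral_mul _ hum (hNm.pow_const _)]
          congr 1; ext t
          simp only [Pi.mul_apply, hF]
          rw [ENNReal.mul_rpow_of_nonneg _ _ (by linarith : 0 ≤ r), ← ENNReal.rpow_mul,
            show (s-1) * r = s by linarith]
          have : σ t * (σ t)⁻¹ ^ r = u t := by
            simp only [hσ, hu]
            rw [← ENNReal.rpow_neg, ← ENNReal.rpow_mul, ← ENNReal.rpow_add _ _ (hW0 t) (hWt t)]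
            congr 1
            rw [hr]; field_simp; ring
          rw [← this]; ring
      _ ≤ ((4:ℝ≥0∞) ^ r * K) ^ s * (ENNReal.ofReal Cr * (ENNReal.ofReal Cs *
            ∫⁻ t, (E.indicator 1 t : ℝ≥0∞) ^ s ∂mu)) := by
          gcongr; exact MU_strong mu _ (measurable_one.indicator hE) s hs1
      _ = _ := by
          congr 3
          rw [hv, ← lintegral_indicator_one hE]
          congr 1; ext t
          by_cases h : t ∈ E <;> simp [h, show 0 < s by linarith]
  have hHol := ENNReal.lintegral_mul_le_Lp_mul_Lq volume hpp (f := fun t => g t * W t)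
    (g := fun t => (W t)⁻¹ * P t ^ (1-α)) (hg.mul hW).aemeasurable
    (hW.inv.mul (hPm.pow_const _)).aemeasurable
  simp only [Pi.mul_apply] at hHol
  set Y := (∫⁻ t, (g t * W t) ^ p) ^ (1/p) with hY
  have hip : 0 ≤ 1 / p' := by positivity
  have hfin : l * v ≤ ENNReal.ofReal (C * (((4:ℝ) ^ r) ^ s * Cr * Cs) ^ (1 / p')) * K ^ (1-α) * Y
      * v ^ (1 - 1/q) := by
    calc l * v ≤ _ := B2
      _ ≤ ENNReal.ofReal C * v ^ α * (Y * (((4:ℝ≥0∞) ^ r * K) ^ s *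
            (ENNReal.ofReal Cr * (ENNReal.ofReal Cs * v))) ^ (1/p')) := by
          gcongr
          exact hHol.trans (mul_le_mul_right (ENNReal.rpow_le_rpow B3 hip) _)
      _ = _ := by
          have e4 : (4:ℝ≥0∞) = ENNReal.ofReal 4 := by simp
          rw [e4, ENNReal.ofReal_rpow_of_pos (by norm_num),
            ENNReal.mul_rpow_of_nonneg _ K (by linarith : 0 ≤ s),
            ENNReal.ofReal_rpow_of_pos (by positivity)]
          have : ENNReal.ofReal (((4:ℝ) ^ r) ^ s) * K ^ s * (ENNReal.ofReal Cr * (ENNReal.ofReal Cs * v))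
              = ENNReal.ofReal (((4:ℝ) ^ r) ^ s * Cr * Cs) * K ^ s * v := by
            rw [ENNReal.ofReal_mul (by positivity), ENNReal.ofReal_mul (by positivity)]; ring
          rw [this, ENNReal.mul_rpow_of_nonneg _ _ hip, ENNReal.mul_rpow_of_nonneg _ _ hip,
            ENNReal.ofReal_rpow_of_pos (by positivity), ← ENNReal.rpow_mul,
            show s * (1/p') = 1 - α by rw [← hrel, hs]; field_simp; ring,
            show 1 - 1/q = α + 1/p' by linarith, ENNReal.rpow_add _ _ hv0 hEf,
            ENNReal.ofReal_mul (by positivity)]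
          ring
  have hvq0 : v ^ (1 - 1/q) ≠ 0 := (ENNReal.rpow_pos (pos_iff_ne_zero.mpr hv0) hEf).ne'
  have hvqt : v ^ (1 - 1/q) ≠ ∞ := ENNReal.rpow_ne_top_of_ne_zero hv0 hEf
  have hvv : v ^ (1/q) * v ^ (1-1/q) = v := by
    rw [← ENNReal.rpow_add _ _ hv0 hEf]; simp
  refine (ENNReal.mul_le_mul_iff_left hvq0 hvqt).mp ?_
  rw [mul_assoc, hvv]
  exact hfin

lemma lower_env (f : ℝ → ℝ≥0∞) (hft : ∀ x, f x ≠ ∞) : ∃ g : ℝ → ℝ≥0∞, Measurable g ∧ (∀ x, g x ≤ f x) ∧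
    ∀ h : ℝ → ℝ≥0∞, Measurable h → (∀ x, h x ≤ f x) → ∀ᵐ x, h x ≤ g x := by
  set μ : Measure ℝ := (volume : Measure ℝ).toFinite with hμ
  have hex : ∀ n : ℕ, ∃ g : ℝ → ℝ≥0∞, Measurable g ∧ (∀ x, g x ≤ min (f x) n) ∧
      ∀ h : ℝ → ℝ≥0∞, Measurable h → (∀ x, h x ≤ min (f x) n) → ∀ᵐ x, h x ≤ g x := by
    intro n
    obtain ⟨g, hg, hgf, hint⟩ := exists_measurable_le_lintegral_eq (μ := μ) (fun x => min (f x) n)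
    refine ⟨g, hg, hgf, fun h hh hhf => ?_⟩
    have hfin : ∫⁻ x, g x ∂μ ≠ ∞ := by
      rw [← hint]
      refine ne_top_of_le_ne_top ?_ (lintegral_mono (g := fun _ => (n : ℝ≥0∞)) fun x => min_le_right _ _)
      rw [lintegral_const]
      exact ENNReal.mul_ne_top (by simp) (measure_ne_top _ _)
    have := ae_eq_of_ae_le_of_lintegral_le (μ := μ) (f := g) (g := fun x => max (g x) (h x))
      (Eventually.of_forall fun x => le_max_left _ _) hfin (hg.max hh).aemeasurable (by
        rw [← hint]
        exact lintegral_mono fun x => max_le (hgf x) (hhf x))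
    rw [hμ, EventuallyEq, ae_toFinite] at this
    filter_upwards [this] with x hx
    rw [hx]; exact le_max_right _ _
  choose G hGm hGf hGmax using hex
  refine ⟨fun x => ⨆ n, G n x, Measurable.iSup hGm,
    fun x => iSup_le fun n => (hGf n x).trans (min_le_left _ _), fun h hh hhf => ?_⟩
  have : ∀ᵐ x, ∀ n : ℕ, min (h x) (n : ℝ≥0∞) ≤ G n x := by
    rw [ae_all_iff]
    exact fun n => hGmax n _ (hh.min measurable_const) fun x => min_le_min_right _ (hhf x)
  filter_upwards [this] with x hx
  have hxt : h x ≠ ∞ := ne_top_of_le_ne_top (hft x) (hhf x)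
  obtain ⟨n, hn⟩ := ENNReal.exists_nat_gt hxt
  refine le_trans ?_ (le_iSup (fun n => G n x) n)
  have := hx n
  rwa [min_eq_left hn.le] at this

lemma Ralpha_le (α : ℝ) (f : ℝ → ℝ) (g : ℝ → ℝ≥0∞)
    (hmax : ∀ h : ℝ → ℝ≥0∞, Measurable h → (∀ x, h x ≤ ENNReal.ofReal |f x|) → ∀ᵐ x, h x ≤ g x)
    (x : ℝ) : Ralpha α f x ≤ ∫⁻ t in Iio x, g t * ENNReal.ofReal ((x - t) ^ (α - 1)) := by
  unfold Ralpha
  obtain ⟨H, hH, hHf, hint⟩ := exists_measurable_le_lintegral_eq (μ := volume.restrict (Iio x))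
    (fun t => ENNReal.ofReal (|f t| * (x - t) ^ (α - 1)))
  rw [hint]
  set k : ℝ → ℝ≥0∞ := fun t => ENNReal.ofReal ((x - t) ^ (α - 1)) with hk
  have hkm : Measurable k := ((measurable_id.const_sub x).pow_const _).ennreal_ofReal
  have hk0 : ∀ t, t < x → k t ≠ 0 := by
    intro t ht
    simp only [hk, ne_eq, ENNReal.ofReal_eq_zero, not_le]
    exact Real.rpow_pos_of_pos (by linarith) _
  have hkt : ∀ t, k t ≠ ∞ := fun t => ENNReal.ofReal_ne_top
  have := hmax ((Iio x).indicator (fun t => H t / k t)) ((hH.div hkm).indicator measurableSet_Iio) (by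
    intro t
    by_cases ht : t < x
    · rw [indicator_of_mem (show t ∈ Iio x from ht)]
      rw [ENNReal.div_le_iff (hk0 t ht) (hkt t)]
      refine (hHf t).trans (le_of_eq ?_)
      simp only [hk]
      rw [← ENNReal.ofReal_mul (abs_nonneg _)]
    · rw [indicator_of_notMem (show t ∉ Iio x from ht)]; exact zero_le)
  refine lintegral_mono_ae ?_
  refine (ae_restrict_iff' measurableSet_Iio).mpr ?_
  filter_upwards [this] with t ht htx
  rw [indicator_of_mem htx] at ht
  rwa [ENNReal.div_le_iff (hk0 t htx) (hkt t)] at ht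

lemma wd_ne_zero (u : ℝ → ℝ≥0∞) (hu : Measurable u) (hu0 : ∀ x, u x ≠ 0) (a b : ℝ) (hab : a < b) :
    (volume.withDensity u) (Ioo a b) ≠ 0 := by
  rw [withDensity_apply _ measurableSet_Ioo]
  refine ((setLIntegral_pos_iff hu).mpr ?_).ne'
  have : Function.support u = univ := by ext x; simp [hu0]
  rw [this, univ_inter, Real.volume_Ioo]
  simpa using hab

lemma lint_eq (w w' : ℝ → ℝ) (hww : w =ᵐ[volume] w') (hpos : ∀ x, 0 < w' x) (e : ℝ) (A : Set ℝ)
    (hA : MeasurableSet A) :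
    ∫⁻ t in A, ENNReal.ofReal (w t ^ e) = (volume.withDensity (fun x => ENNReal.ofReal (w' x) ^ e)) A := by
  rw [withDensity_apply _ hA]
  refine lintegral_congr_ae (ae_restrict_of_ae ?_)
  filter_upwards [hww] with t ht
  rw [ht, ENNReal.ofReal_rpow_of_pos (hpos t)]

/-- Weak-type sharp bound for the Riemann–Liouville operator:
`‖R_α‖_{L^p_{w^p} → L^{q,∞}_{w^q}} ≤ c ‖w‖_{A_{p,q}^-}^{1-α}`. -/
theorem stmt11 (p q α : ℝ) (hα : 0 < α) (hα1 : α < 1) (hp : 1 < p) (hpα : p < 1 / α)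
    (hq : q = p / (1 - α * p)) :
    ∃ c : ℝ, 0 < c ∧
      ∀ w : ℝ → ℝ, IsWeight w → apqMinusChar p q w ≠ ∞ →
        ∀ f : ℝ → ℝ,
          wkNormW q (fun x => w x ^ q) (Ralpha α f) ≤
            ENNReal.ofReal c * apqMinusChar p q w ^ (1 - α) *
              lnormW p (fun x => w x ^ p) (fun x => ENNReal.ofReal |f x|) := by
  set p' := p / (p - 1) with hp'
  have hpp : p.HolderConjugate p' := Real.HolderConjugate.conjExponent hp
  have hp0 : 0 < p := by linarith
  have hp'0 : 0 < p' := hpp.symm.pos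
  have hαp : α * p < 1 := by
    rw [lt_div_iff₀ hα] at hpα; linarith
  have hq0 : 0 < q := by rw [hq]; exact div_pos hp0 (by linarith)
  have hrel : 1 / q + 1 / p' = 1 - α := by
    have h1 : 1 - α * p ≠ 0 := by linarith
    have h2 : p - 1 ≠ 0 := by linarith
    rw [hq, hp']; field_simp; ring
  obtain ⟨c, hc, hcore⟩ := core_bound p q α p' (1 + q / p') (1 + p' / q) hα hα1 hpp hq0 rfl rfl hrel
  refine ⟨c, hc, ?_⟩
  intro w hw hKt f
  set K := apqMinusChar p q w with hK
  -- measurable positive representative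
  have hws : AEStronglyMeasurable w volume := hw.2.aestronglyMeasurable
  set m := hws.mk w with hm
  have hmm : Measurable m := hws.stronglyMeasurable_mk.measurable
  set w' : ℝ → ℝ := fun x => if 0 < m x then m x else 1 with hw'
  have hw'm : Measurable w' :=
    Measurable.ite (measurableSet_lt measurable_const hmm) hmm measurable_const
  have hpos : ∀ x, 0 < w' x := by
    intro x; simp only [hw']; split_ifs with h
    · exact h
    · norm_num
  have hww : w =ᵐ[volume] w' := by
    filter_upwards [hws.ae_eq_mk, hw.1] with x hx hx0
    have : m x = w x := hx.symm
    simp only [hw', this, hx0, if_true]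
  set W : ℝ → ℝ≥0∞ := fun x => ENNReal.ofReal (w' x) with hW
  have hWm : Measurable W := hw'm.ennreal_ofReal
  have hW0 : ∀ x, W x ≠ 0 := fun x => by simpa [hW] using hpos x
  have hWt : ∀ x, W x ≠ ∞ := fun x => ENNReal.ofReal_ne_top
  have hWe0 : ∀ (e : ℝ) x, W x ^ e ≠ 0 := fun e x => (ENNReal.rpow_pos (hW0 x).bot_lt (hWt x)).ne'
  set mu := volume.withDensity (fun x => W x ^ q) with hmu
  set ms := volume.withDensity (fun x => W x ^ (-p')) with hms
  have hU0 : ∀ a b, a < b → mu (Ioo a b) ≠ 0 := fun a b hab =>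
    wd_ne_zero _ (hWm.pow_const _) (hWe0 _) a b hab
  have hS0 : ∀ a b, a < b → ms (Ioo a b) ≠ 0 := fun a b hab =>
    wd_ne_zero _ (hWm.pow_const _) (hWe0 _) a b hab
  have hlu : ∀ a b, lintIoc (fun t => w t ^ q) a b = mu (Ioo a b) := by
    intro a b
    unfold lintIoc
    rw [lint_eq w w' hww hpos q _ measurableSet_Ioc]
    exact measure_congr (Ioo_ae_eq_Ioc (μ := mu)).symm
  have hls : ∀ a b, lintIoc (fun t => w t ^ (-p')) a b = ms (Ioo a b) := by
    intro a b
    unfold lintIoc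
    rw [lint_eq w w' hww hpos (-p') _ measurableSet_Ioc]
    exact measure_congr (Ioo_ae_eq_Ioc (μ := ms)).symm
  have hqp : 0 < q / p' := by positivity
  have hcond : ∀ x d : ℝ, 0 < d → mu (Ioo x (x+d)) * ms (Ioo (x-d) x) ^ (1 + q / p' - 1)
      ≤ K * ENNReal.ofReal d ^ (1 + q / p') := by
    intro x d hd
    have h1 : avgIoc (fun t => w t ^ q) x (x + d) *
      avgIoc (fun t => w t ^ (-(p / (p - 1)))) (x - d) x ^ (q / (p / (p - 1))) ≤ K := by
      rw [hK]; unfold apqMinusChar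
      exact le_iSup_of_le x (le_iSup_of_le d (le_iSup_of_le hd le_rfl))
    rw [← hp'] at h1
    unfold avgIoc at h1
    rw [hlu, hls, add_sub_cancel_left, sub_sub_cancel] at h1
    rw [add_sub_cancel_left]
    set D := ENNReal.ofReal d with hD
    have hD0 : D ≠ 0 := by simpa [hD] using hd
    have hDt : D ≠ ∞ := ENNReal.ofReal_ne_top
    have hDD : D * D⁻¹ = 1 := ENNReal.mul_inv_cancel hD0 hDt
    set U := mu (Ioo x (x+d))
    set S := ms (Ioo (x-d) x)
    calc U * S ^ (q/p') = (D * D⁻¹) * U * ((D * D⁻¹) * S) ^ (q/p') := by rw [hDD, one_mul, one_mul]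
      _ = (D⁻¹ * U * (D⁻¹ * S) ^ (q/p')) * (D * D ^ (q/p')) := by
          rw [mul_assoc D D⁻¹ S, ENNReal.mul_rpow_of_nonneg D _ hqp.le]; ring
      _ ≤ K * (D * D ^ (q/p')) := by gcongr
      _ = _ := by rw [ENNReal.rpow_add _ _ hD0 hDt, ENNReal.rpow_one]
  have hRt : ∀ d : ℝ, 0 < d → K * ENNReal.ofReal d ^ (1 + q / p') ≠ ∞ := fun d hd =>
    ENNReal.mul_ne_top hKt (ENNReal.rpow_ne_top_of_nonneg (by positivity) ENNReal.ofReal_ne_top)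
  have hqp' : 0 < 1 + q / p' - 1 := by linarith
  have hUf : ∀ a b, mu (Ioo a b) ≠ ∞ := by
    intro a b
    rcases lt_or_ge a b with hab | hab
    · intro htop
      have h1 := hcond a (b-a) (by linarith)
      rw [show a + (b - a) = b by ring, htop, ENNReal.top_mul] at h1
      · exact hRt (b-a) (by linarith) (top_le_iff.mp h1)
      · rw [ne_eq, ENNReal.rpow_eq_zero_iff_of_pos hqp']
        exact hS0 _ _ (by linarith)
    · rw [Ioo_eq_empty (not_lt.mpr hab)]; simp
  have hSf : ∀ a b, ms (Ioo a b) ≠ ∞ := by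
    intro a b
    rcases lt_or_ge a b with hab | hab
    · intro htop
      have h1 := hcond b (b-a) (by linarith)
      rw [show b - (b - a) = a by ring, htop, ENNReal.top_rpow_of_pos hqp', ENNReal.mul_top] at h1
      · exact hRt (b-a) (by linarith) (top_le_iff.mp h1)
      · exact hU0 _ _ (by linarith)
    · rw [Ioo_eq_empty (not_lt.mpr hab)]; simp
  -- lower envelope of f
  obtain ⟨g, hg, hgf, hgmax⟩ := lower_env (fun x => ENNReal.ofReal |f x|) (fun x => ENNReal.ofReal_ne_top)
  have hcore' := hcore W hWm hW0 hWt K hUf hU0 hSf hS0 hcond g hg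
  set Rg : ℝ → ℝ≥0∞ := fun x => ∫⁻ t in Iio x, g t * ENNReal.ofReal ((x - t) ^ (α - 1)) with hRg
  have hRgm : Measurable Rg := by
    have h1 : Rg = fun x => ∫⁻ t, (if t < x then g t * ENNReal.ofReal ((x - t) ^ (α - 1)) else 0) := by
      ext x
      simp only [hRg]
      rw [← lintegral_indicator measurableSet_Iio]
      congr 1
    rw [h1]
    refine Measurable.lintegral_prod_right' (f := fun z : ℝ × ℝ => if z.2 < z.1 then
      g z.2 * ENNReal.ofReal ((z.1 - z.2) ^ (α - 1)) else 0) ?_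
    exact Measurable.ite (measurableSet_lt measurable_snd measurable_fst)
      ((hg.comp measurable_snd).mul
        (((measurable_fst.sub measurable_snd).pow_const _).ennreal_ofReal)) measurable_const
  have hnorm : (∫⁻ t, (g t * W t) ^ p) ^ (1 / p) ≤
      lnormW p (fun x => w x ^ p) (fun x => ENNReal.ofReal |f x|) := by
    unfold lnormW
    refine ENNReal.rpow_le_rpow (lintegral_mono_ae ?_) (by positivity)
    filter_upwards [hww] with t ht
    rw [ENNReal.mul_rpow_of_nonneg _ _ hp0.le, ht, ← ENNReal.ofReal_rpow_of_pos (hpos t)]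
    gcongr
    exact hgf t
  unfold wkNormW
  refine iSup₂_le fun l hl => ?_
  set B := ENNReal.ofReal c * K ^ (1 - α) *
    lnormW p (fun x => w x ^ p) (fun x => ENNReal.ofReal |f x|) with hB
  set A' := {x | ENNReal.ofReal l < Rg x} with hA'
  have hA'm : MeasurableSet A' := measurableSet_lt measurable_const hRgm
  have hl0 : ENNReal.ofReal l ≠ 0 := by simpa using hl
  have hlt : ENNReal.ofReal l ≠ ∞ := ENNReal.ofReal_ne_top
  have hn : ∀ n : ℕ, mu (A' ∩ Ioo (-(n:ℝ)) n) ≤ (B / ENNReal.ofReal l) ^ q := by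
    intro n
    have h1 := hcore' (A' ∩ Ioo (-(n:ℝ)) n) (hA'm.inter measurableSet_Ioo)
      (ne_top_of_le_ne_top (hUf (-(n:ℝ)) n) (measure_mono inter_subset_right))
      (ENNReal.ofReal l) (fun x hx => le_of_lt hx.1)
    have h2 : mu (A' ∩ Ioo (-(n:ℝ)) n) ^ (1/q) ≤ B / ENNReal.ofReal l := by
      rw [ENNReal.le_div_iff_mul_le (Or.inl hl0) (Or.inl hlt), mul_comm]
      refine h1.trans ?_
      rw [hB]; gcongr
    have h3 := ENNReal.rpow_le_rpow h2 hq0.le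
    rwa [← ENNReal.rpow_mul, one_div_mul_cancel hq0.ne', ENNReal.rpow_one] at h3
  have hmuA : mu A' ≤ (B / ENNReal.ofReal l) ^ q := by
    have hU : A' = ⋃ n : ℕ, A' ∩ Ioo (-(n:ℝ)) n := by
      rw [← inter_iUnion]
      symm
      rw [inter_eq_left]
      intro x _
      obtain ⟨n, hn⟩ := exists_nat_gt |x|
      exact mem_iUnion.mpr ⟨n, abs_lt.mp hn⟩
    have hmono : Monotone (fun n : ℕ => A' ∩ Ioo (-(n:ℝ)) n) := by
      intro a b hab
      have : (a:ℝ) ≤ b := by exact_mod_cast hab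
      exact inter_subset_inter_right _ (Ioo_subset_Ioo (by linarith) this)
    rw [hU, hmono.measure_iUnion]
    exact iSup_le hn
  have hsub : {x | ENNReal.ofReal l < Ralpha α f x} ⊆ A' := by
    intro x hx
    exact lt_of_lt_of_le hx (Ralpha_le α f g hgmax x)
  calc _ ≤ ENNReal.ofReal l * (mu A') ^ (1/q) := by
        gcongr
        refine (lintegral_mono_set hsub).trans (le_of_eq ?_)
        exact lint_eq w w' hww hpos q A' hA'm
    _ ≤ ENNReal.ofReal l * ((B / ENNReal.ofReal l) ^ q) ^ (1/q) := by gcongr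
    _ = B := by
        rw [← ENNReal.rpow_mul, mul_one_div_cancel hq0.ne', ENNReal.rpow_one,
          ENNReal.mul_div_cancel hl0 hlt]

end
end

section
/- Let 0<α<1, 1<p<1/α, and q = p/(1−αp). There exists a constant c depending only on p and α such that for every weight w ∈ A_{p,q}^+(ℝ), the Weyl operator W_α is bounded from L^p_{w^p}(ℝ) to the weak space L^{q,∞}_{w^q}(ℝ) with ‖W_α‖_{L^p_{w^p}→L^{q,∞}_{w^q}} ≤ c ‖w‖_{A_{p,q}^+(ℝ)}^{1-α}. -/
open MeasureTheory Set Filter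
open scoped ENNReal

noncomputable section

/-- The one-sided `A_{p,q}^+` characteristic:
`sup_{x,h>0} ((1/h)∫_{x-h}^x u^q)((1/h)∫_x^{x+h} u^{-p'})^{q/p'}`, `p' = p/(p-1)`. -/
def apqPlusChar (p q : ℝ) (u : ℝ → ℝ) : ℝ≥0∞ :=
  ⨆ (x : ℝ) (h : ℝ) (_ : 0 < h),
    avgIoc (fun t => u t ^ q) (x - h) x *
      avgIoc (fun t => u t ^ (-(p / (p - 1)))) x (x + h) ^ (q / (p / (p - 1)))

/-- The Weyl fractional integral (applied to `|f|`):
`W_α f(x) = ∫_x^∞ |f(t)| (t-x)^{α-1} dt`. -/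
def Walpha (α : ℝ) (f : ℝ → ℝ) (x : ℝ) : ℝ≥0∞ :=
  ∫⁻ t in Set.Ioi x, ENNReal.ofReal (|f t| * (t - x) ^ (α - 1))

namespace Wey

lemma lint_pow_fin {β : ℝ} (hβ : 0 < β) {H : ℝ} (hH : 0 ≤ H) :
    ∫⁻ t in Ioc (0:ℝ) H, ENNReal.ofReal (t ^ (β - 1)) = ENNReal.ofReal (1 / β) * ENNReal.ofReal H ^ β := by
  have hint : IntegrableOn (fun t : ℝ => t ^ (β - 1)) (Ioc 0 H) := by
    have := intervalIntegral.intervalIntegrable_rpow' (a := 0) (b := H) (r := β - 1) (by linarith)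
    rwa [intervalIntegrable_iff_integrableOn_Ioc_of_le hH] at this
  rw [← ofReal_integral_eq_lintegral_ofReal hint]
  · rw [← intervalIntegral.integral_of_le hH, integral_rpow (Or.inl (by linarith))]
    rw [ENNReal.ofReal_rpow_of_nonneg hH hβ.le, ← ENNReal.ofReal_mul (by positivity)]
    congr 1
    rw [sub_add_cancel, Real.zero_rpow hβ.ne']
    ring
  · filter_upwards [ae_restrict_mem measurableSet_Ioc] with t ht
    exact Real.rpow_nonneg ht.1.le _

lemma lint_pow {β : ℝ} (hβ : 0 < β) (h : ℝ≥0∞) :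
    ∫⁻ t in Ioi (0:ℝ), (if ENNReal.ofReal t < h then ENNReal.ofReal (t ^ (β - 1)) else 0)
      = ENNReal.ofReal (1 / β) * h ^ β := by
  have hpos : ENNReal.ofReal (1 / β) ≠ 0 := by
    rw [Ne, ENNReal.ofReal_eq_zero, not_le]; positivity
  by_cases hh : h = ∞
  · subst hh
    rw [ENNReal.top_rpow_of_pos hβ, ENNReal.mul_top hpos]
    refine ENNReal.eq_top_of_forall_nnreal_le fun r => ?_
    have key : ∀ H : ℝ, 0 ≤ H → ENNReal.ofReal (1 / β) * ENNReal.ofReal H ^ β ≤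
      ∫⁻ t in Ioi (0:ℝ), (if ENNReal.ofReal t < ∞ then ENNReal.ofReal (t ^ (β - 1)) else 0) := by
      intro H hH
      rw [← lint_pow_fin hβ hH]
      simp only [ENNReal.ofReal_lt_top, if_true]
      exact lintegral_mono_set Ioc_subset_Ioi_self
    refine le_trans ?_ (key ((β * r) ^ (1/β)) (by positivity))
    rw [ENNReal.ofReal_rpow_of_nonneg (by positivity) hβ.le, ← ENNReal.ofReal_mul (by positivity),
      ← Real.rpow_mul (by positivity), one_div_mul_cancel hβ.ne', Real.rpow_one]
    rw [show 1 / β * (β * r) = r by field_simp]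
    simp
  · rw [← ENNReal.ofReal_toReal hh, ← lint_pow_fin hβ ENNReal.toReal_nonneg]
    rw [← restrict_Ioo_eq_restrict_Ioc, ← lintegral_indicator measurableSet_Ioi,
      ← lintegral_indicator measurableSet_Ioo]
    congr 1
    ext t
    simp only [indicator, mem_Ioi, mem_Ioo]
    by_cases ht : 0 < t
    · simp only [ht, if_true, true_and]
      congr 1
      rw [ENNReal.ofReal_lt_ofReal_iff_of_nonneg ht.le]
    · simp [ht]

lemma overlap (S : Finset (ℝ × ℝ)) : ∃ T ⊆ S, (⋃ i ∈ S, Ioo i.1 i.2) ⊆ (⋃ i ∈ T, Ioo i.1 i.2) ∧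
    ∀ x : ℝ, (T.filter (fun i => x ∈ Ioo i.1 i.2)).card ≤ 2 := by
  induction S using Finset.strongInduction with
  | H S ih =>
    by_cases hS : ∀ x : ℝ, (S.filter (fun i => x ∈ Ioo i.1 i.2)).card ≤ 2
    · exact ⟨S, subset_rfl, subset_rfl, hS⟩
    push Not at hS
    obtain ⟨x, hx⟩ := hS
    set F := S.filter (fun i => x ∈ Ioo i.1 i.2) with hF
    have hne : F.Nonempty := Finset.card_pos.1 (by omega)
    obtain ⟨i, hi, hi'⟩ := F.exists_min_image (fun i => i.1) hne
    obtain ⟨j, hj, hj'⟩ := F.exists_max_image (fun i => i.2) hne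
    have : ∃ k ∈ F, k ∉ ({i, j} : Finset (ℝ × ℝ)) := by
      apply Finset.exists_mem_notMem_of_card_lt_card
      exact lt_of_le_of_lt Finset.card_le_two hx
    obtain ⟨k, hk, hk'⟩ := this
    have hik : i ≠ k := by rintro rfl; simp at hk'
    have hjk : j ≠ k := by rintro rfl; simp at hk'
    have hkS : k ∈ S := (Finset.mem_filter.1 hk).1
    obtain ⟨T, hT, hcov, hc⟩ := ih (S.erase k) (Finset.erase_ssubset hkS)
    refine ⟨T, hT.trans (Finset.erase_subset _ _), ?_, hc⟩
    refine Subset.trans ?_ hcov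
    intro y hy
    simp only [mem_iUnion, exists_prop] at hy ⊢
    obtain ⟨m, hm, hym⟩ := hy
    by_cases hmk : m = k
    · subst hmk
      by_cases hyx : y < x
      · refine ⟨i, Finset.mem_erase.2 ⟨hik, (Finset.mem_filter.1 hi).1⟩, ?_, ?_⟩
        · exact lt_of_le_of_lt (hi' _ hk) hym.1
        · exact hyx.trans ((Finset.mem_filter.1 hi).2).2
      · refine ⟨j, Finset.mem_erase.2 ⟨hjk, (Finset.mem_filter.1 hj).1⟩, ?_, ?_⟩
        · exact lt_of_lt_of_le ((Finset.mem_filter.1 hj).2).1 (not_lt.1 hyx)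
        · exact lt_of_lt_of_le hym.2 (hj' _ hk)
    · exact ⟨m, Finset.mem_erase.2 ⟨hmk, hm⟩, hym⟩

/-- uncentered maximal function -/
def Mx (μ : Measure ℝ) (g : ℝ → ℝ≥0∞) (x : ℝ) : ℝ≥0∞ :=
  ⨆ (i : ℝ × ℝ) (_ : x ∈ Ioo i.1 i.2), (∫⁻ y in Ioo i.1 i.2, g y ∂μ) / μ (Ioo i.1 i.2)

lemma Mx_set (μ : Measure ℝ) (g : ℝ → ℝ≥0∞) (l : ℝ≥0∞) :
    {x | l < Mx μ g x} = ⋃ i : {i : ℝ × ℝ // l < (∫⁻ y in Ioo i.1 i.2, g y ∂μ) / μ (Ioo i.1 i.2)},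
      Ioo i.1.1 i.1.2 := by
  ext x
  simp only [Mx, mem_ofPred_eq, lt_iSup_iff, mem_iUnion, Subtype.exists, exists_prop]
  exact ⟨fun ⟨i, a, b⟩ => ⟨i, b, a⟩, fun ⟨i, a, b⟩ => ⟨i, b, a⟩⟩

lemma Mx_isOpen (μ : Measure ℝ) (g : ℝ → ℝ≥0∞) (l : ℝ≥0∞) : IsOpen {x | l < Mx μ g x} := by
  rw [Mx_set]; exact isOpen_iUnion fun _ => isOpen_Ioo

lemma Mx_meas (μ : Measure ℝ) (g : ℝ → ℝ≥0∞) : Measurable (Mx μ g) :=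
  measurable_of_Ioi fun l => (Mx_isOpen μ g l).measurableSet

lemma weak_fin (μ : Measure ℝ) (g : ℝ → ℝ≥0∞) (hg : Measurable g) (l : ℝ≥0∞) (S : Finset (ℝ × ℝ))
    (hS : ∀ i ∈ S, l < (∫⁻ y in Ioo i.1 i.2, g y ∂μ) / μ (Ioo i.1 i.2)) :
    l * μ (⋃ i ∈ S, Ioo i.1 i.2) ≤ 2 * ∫⁻ y, g y ∂μ := by
  obtain ⟨T, hT, hcov, hc⟩ := overlap S
  calc l * μ (⋃ i ∈ S, Ioo i.1 i.2) ≤ l * ∑ i ∈ T, μ (Ioo i.1 i.2) := by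
        gcongr
        exact (measure_mono hcov).trans (measure_biUnion_finset_le _ _)
    _ = ∑ i ∈ T, l * μ (Ioo i.1 i.2) := by rw [Finset.mul_sum]
    _ ≤ ∑ i ∈ T, ∫⁻ y in Ioo i.1 i.2, g y ∂μ :=
        Finset.sum_le_sum fun i hi => ENNReal.mul_le_of_le_div (hS i (hT hi)).le
    _ = ∫⁻ y, ∑ i ∈ T, (Ioo i.1 i.2).indicator g y ∂μ := by
        rw [lintegral_finsetSum _ (fun i _ => hg.indicator measurableSet_Ioo)]
        simp_rw [lintegral_indicator measurableSet_Ioo]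
    _ ≤ ∫⁻ y, 2 * g y ∂μ := by
        refine lintegral_mono fun y => ?_
        have : ∑ i ∈ T, (Ioo i.1 i.2).indicator g y =
            ((T.filter (fun i => y ∈ Ioo i.1 i.2)).card : ℝ≥0∞) * g y := by
          rw [← nsmul_eq_mul, ← Finset.sum_const, Finset.sum_filter]
          refine Finset.sum_congr rfl fun i _ => ?_
          rw [indicator_apply]
        show ∑ i ∈ T, (Ioo i.1 i.2).indicator g y ≤ _
        rw [this]
        gcongr
        exact_mod_cast hc y
    _ = 2 * ∫⁻ y, g y ∂μ := lintegral_const_mul _ hg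

lemma weak (μ : Measure ℝ) (g : ℝ → ℝ≥0∞) (hg : Measurable g) (l : ℝ≥0∞) :
    l * μ {x | l < Mx μ g x} ≤ 2 * ∫⁻ y, g y ∂μ := by
  rw [Mx_set]
  obtain ⟨T, hTc, hT⟩ := TopologicalSpace.isOpen_iUnion_countable
    (fun i : {i : ℝ × ℝ // l < (∫⁻ y in Ioo i.1 i.2, g y ∂μ) / μ (Ioo i.1 i.2)} => Ioo i.1.1 i.1.2)
    (fun _ => isOpen_Ioo)
  rw [← hT]
  have := hTc.to_subtype
  rw [biUnion_eq_iUnion, iUnion_eq_iUnion_finset, Directed.measure_iUnion, ENNReal.mul_iSup]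
  · refine iSup_le fun F => ?_
    classical
    have := weak_fin μ g hg l (F.image (fun x => x.1.1)) (by
      intro i hi
      obtain ⟨x, _, rfl⟩ := Finset.mem_image.1 hi
      exact x.1.2)
    refine le_trans ?_ this
    gcongr
    intro y hy
    simp only [mem_iUnion, exists_prop] at hy ⊢
    obtain ⟨x, hx, hy⟩ := hy
    exact ⟨x.1.1, Finset.mem_image_of_mem _ hx, hy⟩
  · exact Monotone.directed_le fun A B hAB => biUnion_subset_biUnion_left hAB

lemma weak2 (μ : Measure ℝ) (g : ℝ → ℝ≥0∞) (hg : Measurable g) {t : ℝ} (ht : 0 < t) :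
    ENNReal.ofReal t * μ {x | ENNReal.ofReal t < Mx μ g x} ≤
      4 * ∫⁻ y, (if ENNReal.ofReal t < 2 * g y then g y else 0) ∂μ := by
  set g1 : ℝ → ℝ≥0∞ := fun y => if ENNReal.ofReal t < 2 * g y then g y else 0 with hg1
  have hg1m : Measurable g1 :=
    Measurable.ite (measurableSet_lt measurable_const (hg.const_mul 2)) hg measurable_const
  have hh : ENNReal.ofReal t = ENNReal.ofReal (t/2) + ENNReal.ofReal (t/2) := by
    rw [← ENNReal.ofReal_add (by positivity) (by positivity)]; congr 1; ring
  have hle : ∀ x, Mx μ g x ≤ Mx μ g1 x + ENNReal.ofReal (t/2) := by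
    intro x
    refine iSup₂_le fun i hi => ?_
    have h1 : ∫⁻ y in Ioo i.1 i.2, g y ∂μ ≤
        (∫⁻ y in Ioo i.1 i.2, g1 y ∂μ) + ENNReal.ofReal (t/2) * μ (Ioo i.1 i.2) := by
      rw [← setLIntegral_const, ← lintegral_add_left hg1m]
      refine lintegral_mono fun y => ?_
      by_cases h : ENNReal.ofReal t < 2 * g y
      · simp [hg1, h]
      · simp only [hg1, h, if_false, zero_add]
        rw [not_lt, hh, ← two_mul] at h
        exact (ENNReal.mul_le_mul_iff_right (by simp) (by simp)).1 h
    calc _ ≤ ((∫⁻ y in Ioo i.1 i.2, g1 y ∂μ) + ENNReal.ofReal (t/2) * μ (Ioo i.1 i.2)) / μ (Ioo i.1 i.2) :=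
          ENNReal.div_le_div_right h1 _
      _ = (∫⁻ y in Ioo i.1 i.2, g1 y ∂μ) / μ (Ioo i.1 i.2) +
          ENNReal.ofReal (t/2) * μ (Ioo i.1 i.2) / μ (Ioo i.1 i.2) := ENNReal.add_div
      _ ≤ _ := by
        gcongr
        · exact le_iSup₂_of_le i hi le_rfl
        · exact ENNReal.div_le_of_le_mul le_rfl
  have hsub : {x | ENNReal.ofReal t < Mx μ g x} ⊆ {x | ENNReal.ofReal (t/2) < Mx μ g1 x} := by
    intro x hx
    simp only [mem_ofPred_eq] at hx ⊢
    have := hx.trans_le (hle x)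
    rw [hh] at this
    exact lt_of_add_lt_add_right this
  calc _ ≤ ENNReal.ofReal t * μ {x | ENNReal.ofReal (t/2) < Mx μ g1 x} := by gcongr
    _ = 2 * (ENNReal.ofReal (t/2) * μ {x | ENNReal.ofReal (t/2) < Mx μ g1 x}) := by
      rw [hh]; ring
    _ ≤ 2 * (2 * ∫⁻ y, g1 y ∂μ) := mul_le_mul_right (weak μ g1 hg1m _) _
    _ = _ := by rw [← mul_assoc]; norm_num

lemma strong {p : ℝ} (hp : 1 < p) : ∃ C : ℝ≥0∞, C ≠ ∞ ∧ ∀ (μ : Measure ℝ) [SFinite μ]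
    (g : ℝ → ℝ≥0∞), Measurable g → ∫⁻ x, Mx μ g x ^ p ∂μ ≤ C * ∫⁻ x, g x ^ p ∂μ := by
  have hp0 : 0 < p := by linarith
  have hp1 : 0 < p - 1 := by linarith
  refine ⟨ENNReal.ofReal p * 4 * (ENNReal.ofReal (1/(p-1)) * 2 ^ (p-1)), ?_, ?_⟩
  · refine ENNReal.mul_ne_top (ENNReal.mul_ne_top ENNReal.ofReal_ne_top (by simp))
      (ENNReal.mul_ne_top ENNReal.ofReal_ne_top (ENNReal.rpow_ne_top_of_nonneg hp1.le (by simp)))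
  intro μ _ g hg
  have hM := Mx_meas μ g
  have h1 : ∀ x, Mx μ g x ^ p = ENNReal.ofReal p * ∫⁻ t in Ioi (0:ℝ),
      (if ENNReal.ofReal t < Mx μ g x then ENNReal.ofReal (t ^ (p - 1)) else 0) := by
    intro x
    rw [lint_pow hp0, ← mul_assoc, ← ENNReal.ofReal_mul hp0.le, mul_one_div_cancel hp0.ne']
    simp
  have hpw : Measurable fun t : ℝ => ENNReal.ofReal (t ^ (p - 1)) := by fun_prop
  have hpw2 : Measurable fun t : ℝ => ENNReal.ofReal (t ^ (p - 1 - 1)) := by fun_prop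
  have m1 : Measurable (Function.uncurry fun (x t : ℝ) =>
      if ENNReal.ofReal t < Mx μ g x then ENNReal.ofReal (t ^ (p - 1)) else 0) := by
    refine Measurable.ite (measurableSet_lt ?_ ?_) (hpw.comp measurable_snd) measurable_const
    · exact ENNReal.measurable_ofReal.comp measurable_snd
    · exact hM.comp measurable_fst
  have m2 : Measurable (Function.uncurry fun (t x : ℝ) =>
      ENNReal.ofReal (t ^ (p - 1 - 1)) * (if ENNReal.ofReal t < 2 * g x then g x else 0)) := by
    refine (hpw2.comp measurable_fst).mul
      (Measurable.ite (measurableSet_lt ?_ ?_) (hg.comp measurable_snd) measurable_const)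
    · exact ENNReal.measurable_ofReal.comp measurable_fst
    · exact (hg.comp measurable_snd).const_mul 2
  calc ∫⁻ x, Mx μ g x ^ p ∂μ
      = ENNReal.ofReal p * ∫⁻ x, (∫⁻ t in Ioi (0:ℝ),
      (if ENNReal.ofReal t < Mx μ g x then ENNReal.ofReal (t ^ (p - 1)) else 0)) ∂μ := by
        simp_rw [h1]
        rw [lintegral_const_mul' _ _ ENNReal.ofReal_ne_top]
    _ = ENNReal.ofReal p * ∫⁻ t in Ioi (0:ℝ), ∫⁻ x,
      (if ENNReal.ofReal t < Mx μ g x then ENNReal.ofReal (t ^ (p - 1)) else 0) ∂μ := by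
        rw [lintegral_lintegral_swap m1.aemeasurable]
    _ ≤ ENNReal.ofReal p * ∫⁻ t in Ioi (0:ℝ), 4 * ∫⁻ x,
      ENNReal.ofReal (t ^ (p - 1 - 1)) * (if ENNReal.ofReal t < 2 * g x then g x else 0) ∂μ := by
        refine mul_le_mul_right ?_ _
        refine setLIntegral_mono' measurableSet_Ioi fun t ht => ?_
        have ht : 0 < t := ht
        rw [lintegral_const_mul' _ _ ENNReal.ofReal_ne_top]
        have e : ∀ x, (if ENNReal.ofReal t < Mx μ g x then ENNReal.ofReal (t ^ (p - 1)) else 0) =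
            {x | ENNReal.ofReal t < Mx μ g x}.indicator (fun _ => ENNReal.ofReal (t ^ (p - 1))) x := by
          intro x; rw [indicator_apply]; rfl
        simp_rw [e]
        rw [lintegral_indicator (Mx_isOpen μ g _).measurableSet, setLIntegral_const]
        have : ENNReal.ofReal (t ^ (p - 1)) = ENNReal.ofReal (t ^ (p - 1 - 1)) * ENNReal.ofReal t := by
          rw [← ENNReal.ofReal_mul (by positivity)]
          congr 1
          rw [Real.rpow_sub_one ht.ne' (p-1)]; field_simp
        rw [this, mul_assoc, ← mul_assoc 4, mul_comm 4, mul_assoc]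
        exact mul_le_mul_right (weak2 μ g hg ht) _
    _ = ENNReal.ofReal p * (4 * ∫⁻ x, (∫⁻ t in Ioi (0:ℝ),
      ENNReal.ofReal (t ^ (p - 1 - 1)) * (if ENNReal.ofReal t < 2 * g x then g x else 0)) ∂μ) := by
        rw [lintegral_const_mul' _ _ (by simp), lintegral_lintegral_swap m2.aemeasurable]
    _ = ENNReal.ofReal p * (4 * ∫⁻ x, (ENNReal.ofReal (1/(p-1)) * 2 ^ (p-1)) * g x ^ p ∂μ) := by
        congr 3
        ext x
        have e : ∀ t : ℝ, ENNReal.ofReal (t ^ (p - 1 - 1)) * (if ENNReal.ofReal t < 2 * g x then g x else 0)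
          = (if ENNReal.ofReal t < 2 * g x then ENNReal.ofReal (t ^ (p - 1 - 1)) else 0) * g x := by
          intro t; split_ifs <;> simp
        simp_rw [e]
        rw [lintegral_mul_const, lint_pow hp1, ENNReal.mul_rpow_of_nonneg _ _ hp1.le, mul_assoc, mul_assoc, mul_assoc]
        · congr 2
          nth_rewrite 2 [← ENNReal.rpow_one (g x)]
          rw [← ENNReal.rpow_add_of_nonneg _ _ hp1.le zero_le_one, sub_add_cancel]
        · exact Measurable.ite (measurableSet_lt ENNReal.measurable_ofReal measurable_const) hpw2 measurable_const
    _ = _ := by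
        rw [lintegral_const_mul' _ _ (ENNReal.mul_ne_top ENNReal.ofReal_ne_top (ENNReal.rpow_ne_top_of_nonneg hp1.le (by simp)))]
        ring

lemma Mx_le (μ : Measure ℝ) (g : ℝ → ℝ≥0∞) {a b y : ℝ} (hy : y ∈ Ioo a b) (hf : μ (Ioo a b) ≠ ∞) :
    ∫⁻ z in Ioo a b, g z ∂μ ≤ Mx μ g y * μ (Ioo a b) := by
  by_cases h0 : μ (Ioo a b) = 0
  · rw [Measure.restrict_eq_zero.2 h0]; simp
  · rw [← ENNReal.div_le_iff h0 hf]
    exact le_iSup₂_of_le (f := fun (i : ℝ × ℝ) (_ : y ∈ Ioo i.1 i.2) =>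
      (∫⁻ y in Ioo i.1 i.2, g y ∂μ) / μ (Ioo i.1 i.2)) (a, b) hy le_rfl

lemma Mx_left (μ : Measure ℝ) (hfin : ∀ a b, μ (Ioc a b) ≠ ∞) (g : ℝ → ℝ≥0∞) {b x : ℝ}
    (hbx : b < x) (hpos : μ (Ioc b x) ≠ 0) :
    ∫⁻ z in Ioc b x, g z ∂μ ≤ Mx μ g x * μ (Ioc b x) := by
  by_cases hM : Mx μ g x = ∞
  · rw [hM, ENNReal.top_mul hpos]; exact le_top
  have hset : (⋂ n : ℕ, Ioo b (x + 1 / ((n : ℝ) + 1))) = Ioc b x := by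
    ext y
    simp only [mem_iInter, mem_Ioo, mem_Ioc]
    constructor
    · intro h
      refine ⟨(h 0).1, ?_⟩
      refine le_of_forall_pos_lt_add fun ε hε => ?_
      obtain ⟨n, hn⟩ := exists_nat_one_div_lt hε
      have := (h n).2
      linarith
    · intro h n
      refine ⟨h.1, ?_⟩
      have : (0:ℝ) < 1 / ((n:ℝ) + 1) := by positivity
      linarith [h.2]
  have hlim : Tendsto (fun n : ℕ => Mx μ g x * μ (Ioo b (x + 1 / ((n : ℝ) + 1)))) atTop
      (nhds (Mx μ g x * μ (Ioc b x))) := by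
    refine ENNReal.Tendsto.const_mul ?_ (Or.inr hM)
    rw [← hset]
    refine tendsto_measure_iInter_atTop (fun i => measurableSet_Ioo.nullMeasurableSet) ?_ ⟨0, ?_⟩
    · intro m n hmn
      apply Ioo_subset_Ioo_right
      have : 1 / ((n:ℝ) + 1) ≤ 1 / ((m:ℝ) + 1) := Nat.one_div_le_one_div hmn
      linarith
    · exact ne_top_of_le_ne_top (hfin _ _) (measure_mono Ioo_subset_Ioc_self)
  refine ge_of_tendsto' hlim fun n => ?_
  have hp : (0:ℝ) < 1 / ((n:ℝ) + 1) := by positivity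
  refine le_trans ?_ (Mx_le μ g (a := b) (y := x) ⟨hbx, by linarith⟩
    (ne_top_of_le_ne_top (hfin _ _) (measure_mono Ioo_subset_Ioc_self)))
  exact lintegral_mono_set fun z hz => ⟨hz.1, by linarith [hz.2]⟩

lemma sum_Ioc (ν : Measure ℝ) (t : ℕ → ℝ) {j N : ℕ} (h : j ≤ N) :
    ν (Ioc (t j) (t N)) ≤ ∑ i ∈ Finset.Ico j N, ν (Ioc (t i) (t (i+1))) := by
  induction N, h using Nat.le_induction with
  | base => simp
  | succ n hn ih =>
    rw [Finset.sum_Ico_succ_top hn]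
    calc _ ≤ ν (Ioc (t j) (t n) ∪ Ioc (t n) (t (n+1))) := measure_mono Ioc_subset_Ioc_union_Ioc
      _ ≤ _ := (measure_union_le _ _).trans (by gcongr)

lemma wd_apply (u : ℝ → ℝ≥0∞) (a b : ℝ) :
    (volume.withDensity u) (Ioc a b) = ∫⁻ t in Ioc a b, u t := withDensity_apply _ measurableSet_Ioc

lemma wd_pos {u : ℝ → ℝ≥0∞} (hu : Measurable u) (h0 : ∀ x, u x ≠ 0) {a b : ℝ} (hab : a < b) :
    (volume.withDensity u) (Ioc a b) ≠ 0 := by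
  rw [wd_apply, ← pos_iff_ne_zero, setLIntegral_pos_iff hu]
  have : Function.support u = univ := by ext x; simp [h0 x]
  rw [this]; simp [hab]

lemma seq {u : ℝ → ℝ≥0∞} (hu : Measurable u) (h0 : ∀ x, u x ≠ 0)
    (hfin : ∀ a b, (volume.withDensity u) (Ioc a b) ≠ ∞) {a c x : ℝ} (hac : a < c) (hcx : c < x) :
    ∃ (t : ℕ → ℝ) (N : ℕ), Monotone t ∧ t 0 = c ∧ (∀ j, t j ≤ x) ∧ t N = x ∧
      (∀ j, (volume.withDensity u) (Ioc a (t j)) ≤ 2 ^ j * (volume.withDensity u) (Ioc a c)) ∧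
      (∀ j, t (j+1) < x → (volume.withDensity u) (Ioc (t j) (t (j+1))) =
        2 ^ j * (volume.withDensity u) (Ioc a c)) := by
  set μ := volume.withDensity u with hμ
  set U : ℝ → ℝ := fun y => (μ (Ioc a y)).toReal with hU
  have hof : ∀ y, ENNReal.ofReal (U y) = μ (Ioc a y) := fun y => ENNReal.ofReal_toReal (hfin _ _)
  have hadd : ∀ y z, a ≤ y → y ≤ z → μ (Ioc a z) = μ (Ioc a y) + μ (Ioc y z) := by
    intro y z h1 h2
    rw [← Ioc_union_Ioc_eq_Ioc h1 h2, measure_union (Ioc_disjoint_Ioc_of_le le_rfl) measurableSet_Ioc]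
  have hadd' : ∀ y z, a ≤ y → y ≤ z → U z = U y + (μ (Ioc y z)).toReal := by
    intro y z h1 h2
    rw [hU]; simp only; rw [hadd y z h1 h2, ENNReal.toReal_add (hfin _ _) (hfin _ _)]
  have hposm : ∀ y z, y < z → 0 < (μ (Ioc y z)).toReal := fun y z h =>
    ENNReal.toReal_pos (wd_pos hu h0 h) (hfin _ _)
  have hstrict : ∀ y z, a ≤ y → y < z → U y < U z := by
    intro y z h1 h2
    rw [hadd' y z h1 h2.le]; linarith [hposm y z h2]
  have hmono : ∀ y z, a ≤ y → a ≤ z → U y ≤ U z → y ≤ z := by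
    intro y z h1 h2 h3
    by_contra h
    exact absurd (hstrict z y h2 (not_le.1 h)) (not_lt.2 h3)
  have hcont : ContinuousOn U (Icc a x) := by
    have hi : IntegrableOn (fun y => (u y).toReal) (Icc a x) := by
      rw [integrableOn_Icc_iff_integrableOn_Ioc]
      exact integrable_toReal_of_lintegral_ne_top hu.aemeasurable (by rw [← wd_apply]; exact hfin _ _)
    refine (intervalIntegral.continuousOn_primitive hi).congr fun y hy => ?_
    have hne : ∫⁻ t in Ioc a y, u t ≠ ∞ := by rw [← wd_apply]; exact hfin _ _
    show U y = ∫ t in Ioc a y, (u t).toReal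
    rw [integral_toReal hu.aemeasurable (ae_lt_top hu hne), ← wd_apply]
  have hΦ : 0 < U c := hposm a c hac
  have hcx' : U c ≤ U x := (hstrict c x hac.le hcx).le
  have hex : ∀ j : ℕ, ∃ y ∈ Icc c x, U y = min (2 ^ j * U c) (U x) := by
    intro j
    have := intermediate_value_Icc hcx.le (hcont.mono (Icc_subset_Icc_left hac.le))
    apply this
    refine ⟨le_min ?_ hcx', min_le_right _ _⟩
    have : (1:ℝ) ≤ 2 ^ j := one_le_pow₀ (by norm_num)
    nlinarith
  choose t ht1 ht2 using hex
  have hat : ∀ j, a ≤ t j := fun j => hac.le.trans (ht1 j).1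
  have htm : Monotone t := by
    refine monotone_nat_of_le_succ fun j => hmono _ _ (hat _) (hat _) ?_
    rw [ht2, ht2]
    gcongr
    · norm_num
    · omega
  obtain ⟨N, hN⟩ := pow_unbounded_of_one_lt (U x / U c) (one_lt_two)
  have htU : ∀ j, t (j+1) < x → U (t (j+1)) = 2 ^ (j+1) * U c := by
    intro j hj
    have := hstrict _ _ (hat _) hj
    rw [ht2] at this ⊢
    apply min_eq_left
    by_contra h
    rw [min_eq_right (not_le.1 h).le] at this
    exact lt_irrefl _ this
  refine ⟨t, N, htm, ?_, fun j => (ht1 j).2, ?_, ?_, ?_⟩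
  · have : U (t 0) = U c := by rw [ht2]; simp [hcx']
    exact le_antisymm (hmono _ _ (hat _) hac.le this.le) (ht1 0).1
  · have : U (t N) = U x := by
      rw [ht2]; apply min_eq_right
      rw [div_lt_iff₀ hΦ] at hN; exact hN.le
    exact le_antisymm (ht1 N).2 (hmono _ _ (hac.le.trans hcx.le) (hat _) this.ge)
  · intro j
    rw [← hof, ← hof, show (2:ℝ≥0∞) ^ j = ENNReal.ofReal (2 ^ j) by
      rw [ENNReal.ofReal_pow (by norm_num)]; norm_num, ← ENNReal.ofReal_mul (by positivity), ht2]
    exact ENNReal.ofReal_le_ofReal (min_le_left _ _)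
  · intro j hj
    have h1 := htU j hj
    have h2 : U (t j) = 2 ^ j * U c := by
      rw [ht2]; apply min_eq_left
      have : U (t (j+1)) ≤ U x := by rw [ht2]; exact min_le_right _ _
      rw [h1, pow_succ] at this
      have : (0:ℝ) < 2 ^ j * U c := by positivity
      linarith
    have h3 := hadd' _ _ (hat j) (htm (Nat.le_succ j))
    rw [← ENNReal.ofReal_toReal (hfin (t j) (t (j+1))), ← hof, show (2:ℝ≥0∞) ^ j = ENNReal.ofReal (2 ^ j) by
      rw [ENNReal.ofReal_pow (by norm_num)]; norm_num, ← ENNReal.ofReal_mul (by positivity)]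
    congr 1
    rw [Nat.succ_eq_add_one] at h3
    rw [h1, h2, pow_succ] at h3
    linarith

lemma geo {s : ℝ} (hs : 0 < s) (i : ℕ) (Φ : ℝ≥0∞) :
    ∑ j ∈ Finset.range (i+1), (2 ^ j * Φ) ^ s ≤
      ENNReal.ofReal (2 ^ s / (2 ^ s - 1)) * (2 ^ i * Φ) ^ s := by
  set ρ : ℝ := 2 ^ s with hρ
  have hρ1 : 1 < ρ := Real.one_lt_rpow (by norm_num) hs
  have e : ∀ j : ℕ, ((2:ℝ≥0∞) ^ j * Φ) ^ s = ENNReal.ofReal (ρ ^ j) * Φ ^ s := by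
    intro j
    rw [ENNReal.mul_rpow_of_nonneg _ _ hs.le]
    congr 1
    rw [show (2:ℝ≥0∞) ^ j = ENNReal.ofReal (2 ^ j) by
      rw [ENNReal.ofReal_pow (by norm_num)]; norm_num, ENNReal.ofReal_rpow_of_nonneg (by positivity) hs.le]
    congr 1
    rw [hρ, ← Real.rpow_natCast, ← Real.rpow_natCast, ← Real.rpow_mul (by norm_num), ← Real.rpow_mul (by norm_num), mul_comm]
  simp_rw [e]
  rw [← Finset.sum_mul, ← mul_assoc, ← ENNReal.ofReal_mul (by apply div_nonneg <;> linarith),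
    ← ENNReal.ofReal_sum_of_nonneg (fun j _ => by positivity)]
  gcongr
  rw [geom_sum_eq hρ1.ne', pow_succ, div_mul_eq_mul_div]
  gcongr
  · linarith

lemma asym {s : ℝ} (hs : 0 < s) {μ ν : Measure ℝ} {B : ℝ≥0∞}
    (hB : ∀ x h : ℝ, 0 < h → μ (Ioc (x-h) x) ^ s * ν (Ioc x (x+h)) ≤ B * ENNReal.ofReal h ^ (s+1))
    {a b c : ℝ} (hab : a ≤ b) (hbc : b < c) :
    μ (Ioc a b) ^ s * ν (Ioc b c) ≤ B * ENNReal.ofReal (c-a) ^ (s+1) := by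
  refine le_trans ?_ (hB b (c-a) (by linarith))
  gcongr
  · linarith
  · linarith

lemma lerner {s : ℝ} (hs : 0 < s) : ∃ C : ℝ≥0∞, C ≠ ∞ ∧ ∀ (u v : ℝ → ℝ≥0∞), Measurable u → Measurable v →
    (∀ x, u x ≠ 0) → (∀ x, v x ≠ 0) → (∀ x, v x ≠ ∞) → 
    (∀ a b, (volume.withDensity u) (Ioc a b) ≠ ∞) → (∀ a b, (volume.withDensity v) (Ioc a b) ≠ ∞) →
    ∀ B : ℝ≥0∞, (∀ x h : ℝ, 0 < h → (volume.withDensity u) (Ioc (x-h) x) ^ s *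
      (volume.withDensity v) (Ioc x (x+h)) ≤ B * ENNReal.ofReal h ^ (s+1)) →
    ∀ f : ℝ → ℝ≥0∞, ∀ a x : ℝ, a < x →
      (∫⁻ y in Ioc a ((a+x)/2), f y ∂(volume.withDensity u)) ^ s ≤ C * B * ENNReal.ofReal (x-a) ^ s *
        Mx (volume.withDensity v) (fun y => Mx (volume.withDensity u) f y ^ s * (v y)⁻¹) x := by
  refine ⟨2 * (2 ^ s * (ENNReal.ofReal (2 ^ s / (2 ^ s - 1)) * 2 ^ s * 2)), ?_, ?_⟩
  · have : (2:ℝ≥0∞) ^ s ≠ ∞ := ENNReal.rpow_ne_top_of_nonneg hs.le (by simp)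
    finiteness
  intro u v hu hv hu0 hv0 hvt huf hvf B hB f a x hax
  set μ := volume.withDensity u with hμ
  set ν := volume.withDensity v with hν
  set c := (a+x)/2 with hc
  have hac : a < c := by rw [hc]; linarith
  have hcx : c < x := by rw [hc]; linarith
  set G := Mx μ f with hG
  set M := Mx ν (fun y => G y ^ s * (v y)⁻¹) x with hM
  have hGm : Measurable G := Mx_meas _ _
  set F := ∫⁻ y in Ioc a c, f y ∂μ with hF
  obtain ⟨t, N, htm, ht0, htx, htN, htU, htD⟩ := seq hu hu0 huf hac hcx
  rw [← hμ] at htU htD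
  set Φ := μ (Ioc a c) with hΦ
  have hct : ∀ j, c ≤ t j := fun j => ht0 ▸ htm (Nat.zero_le j)
  set h := x - a with hh
  have hh0 : 0 < h := by linarith
  -- step 1
  have s1 : ∀ j, F ^ s * ENNReal.ofReal (t (j+1) - t j) ≤
      2 ^ s * ((2 ^ j * Φ) ^ s * ∫⁻ y in Ioc (t j) x, G y ^ s) := by
    intro j
    have hpt : ∀ y ∈ Ioo (t j) (t (j+1)), F ^ s ≤ 2 ^ s * (2 ^ j * Φ) ^ s * G y ^ s := by
      intro y hy
      rw [← ENNReal.mul_rpow_of_nonneg _ _ hs.le, ← ENNReal.mul_rpow_of_nonneg _ _ hs.le]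
      refine ENNReal.rpow_le_rpow ?_ hs.le
      have hle : μ (Ioo a (t (j+1))) ≤ 2 ^ (j+1) * Φ :=
        (measure_mono Ioo_subset_Ioc_self).trans (htU (j+1))
      calc F ≤ ∫⁻ z in Ioo a (t (j+1)), f z ∂μ :=
            lintegral_mono_set fun z hz => ⟨hz.1, by linarith [hz.2, hct j, hy.1, hy.2]⟩
        _ ≤ G y * μ (Ioo a (t (j+1))) := Mx_le μ f ⟨by linarith [hct j, hy.1], hy.2⟩
            (ne_top_of_le_ne_top (huf _ _) (measure_mono Ioo_subset_Ioc_self))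
        _ ≤ G y * (2 ^ (j+1) * Φ) := by gcongr
        _ = _ := by rw [pow_succ]; ring
    calc F ^ s * ENNReal.ofReal (t (j+1) - t j) = ∫⁻ y in Ioo (t j) (t (j+1)), F ^ s := by
          rw [setLIntegral_const, Real.volume_Ioo]
      _ ≤ ∫⁻ y in Ioo (t j) (t (j+1)), 2 ^ s * (2 ^ j * Φ) ^ s * G y ^ s :=
          setLIntegral_mono' measurableSet_Ioo hpt
      _ = 2 ^ s * (2 ^ j * Φ) ^ s * ∫⁻ y in Ioo (t j) (t (j+1)), G y ^ s :=
          lintegral_const_mul _ (by fun_prop)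
      _ ≤ 2 ^ s * (2 ^ j * Φ) ^ s * ∫⁻ y in Ioc (t j) x, G y ^ s := by
          refine mul_le_mul_right ?_ _
          exact lintegral_mono_set fun z hz => ⟨hz.1, by linarith [hz.2, htx (j+1)]⟩
      _ = _ := by rw [mul_assoc]
  -- step 2
  have s2 : ∀ j, ∫⁻ y in Ioc (t j) x, G y ^ s ≤ M * ν (Ioc (t j) x) := by
    intro j
    rcases (htx j).lt_or_eq with hlt | heq
    · have := Mx_left ν hvf (fun y => G y ^ s * (v y)⁻¹) hlt (wd_pos hv hv0 hlt)
      refine le_trans (le_of_eq ?_) this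
      rw [hν, restrict_withDensity measurableSet_Ioc, lintegral_withDensity_eq_lintegral_mul _ hv (by fun_prop)]
      congr 1
      ext y
      simp only [Pi.mul_apply]
      rw [mul_comm (G y ^ s), ← mul_assoc, ENNReal.mul_inv_cancel (hv0 y) (hvt y), one_mul]
    · rw [heq]; simp
  -- step 3
  have s3 : ∀ i, (2 ^ i * Φ) ^ s * ν (Ioc (t i) (t (i+1))) ≤
      2 ^ s * (B * ENNReal.ofReal h ^ s * ENNReal.ofReal (t (i+1) - (if i = 0 then a else t (i-1)))) := by
    intro i
    have hpow : ∀ z : ℝ, 0 ≤ z → z ≤ h → ENNReal.ofReal z ^ (s+1) ≤ ENNReal.ofReal h ^ s * ENNReal.ofReal z := by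
      intro z hz hzh
      rw [ENNReal.rpow_add_of_nonneg _ _ hs.le zero_le_one, ENNReal.rpow_one]
      gcongr
    rcases (htm (Nat.le_succ i)).lt_or_eq with hlt | heq
    swap
    · rw [Nat.succ_eq_add_one] at heq; rw [heq]; simp
    rw [Nat.succ_eq_add_one] at hlt
    have htix : t i < x := hlt.trans_le (htx _)
    rcases i with _ | i
    · simp only [pow_zero, one_mul, if_true]
      have := asym hs hB (a := a) (b := t 0) (c := t 1) (by rw [ht0]; exact hac.le) hlt
      rw [ht0] at this ⊢
      refine this.trans ?_
      have e1 : (1:ℝ≥0∞) ≤ 2 ^ s := ENNReal.one_le_rpow (by norm_num) hs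
      refine le_trans ?_ (le_mul_of_one_le_left (zero_le) e1)
      rw [mul_assoc]
      gcongr
      simp only [zero_add] at *
      exact hpow _ (by linarith [hct 1]) (by linarith [htx 1])
    · have hne : i + 1 ≠ 0 := by omega
      simp only [hne, if_false, Nat.add_sub_cancel]
      have := asym hs hB (a := t i) (b := t (i+1)) (c := t (i+1+1)) (htm (Nat.le_succ i)) hlt
      rw [htD i htix] at this
      rw [show (2:ℝ≥0∞) ^ (i+1) * Φ = 2 * (2 ^ i * Φ) by rw [pow_succ]; ring,
        ENNReal.mul_rpow_of_nonneg _ _ hs.le, mul_assoc]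
      gcongr 2 ^ s * ?_
      refine this.trans ?_
      rw [mul_assoc]
      gcongr
      exact hpow _ (by linarith [htm (show i ≤ i+1+1 by omega)]) (by linarith [htx (i+1+1), hct i])
  -- telescoping
  have tel1 : ∑ j ∈ Finset.range N, ENNReal.ofReal (t (j+1) - t j) = ENNReal.ofReal (x - c) := by
    rw [← ENNReal.ofReal_sum_of_nonneg (fun j _ => sub_nonneg.2 (htm (Nat.le_succ j))),
      Finset.sum_range_sub, htN, ht0]
  have tel2 : ∑ i ∈ Finset.range N, ENNReal.ofReal (t (i+1) - (if i = 0 then a else t (i-1))) ≤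
      2 * ENNReal.ofReal h := by
    have hle : ∀ i, (if i = 0 then a else t (i-1)) ≤ t i := by
      intro i
      split_ifs with hi
      · subst hi; rw [ht0]; exact hac.le
      · exact htm (by omega)
    have : ∀ i, ENNReal.ofReal (t (i+1) - (if i = 0 then a else t (i-1))) =
       ENNReal.ofReal (t (i+1) - t i) + ENNReal.ofReal (t i - (if i = 0 then a else t (i-1))) := by
      intro i
      rw [← ENNReal.ofReal_add (sub_nonneg.2 (htm (Nat.le_succ i))) (sub_nonneg.2 (hle i))]
      congr 1; ring
    simp_rw [this]
    rw [Finset.sum_add_distrib, tel1, two_mul]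
    gcongr
    · linarith
    · rw [← ENNReal.ofReal_sum_of_nonneg (fun j _ => sub_nonneg.2 (hle j))]
      apply ENNReal.ofReal_le_ofReal
      set d : ℕ → ℝ := fun i => if i = 0 then a else t (i-1) with hd
      have : ∀ i, t i = d (i+1) := fun i => by simp [hd]
      calc _ = ∑ i ∈ Finset.range N, (d (i+1) - d i) :=
            Finset.sum_congr rfl fun i _ => by rw [← this i]
        _ = d N - d 0 := Finset.sum_range_sub _ _
        _ ≤ h := by
          have : d N ≤ t N := hle N
          have h2 : d 0 = a := by simp [hd]
          rw [h2]; linarith [htx N]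
  have main : F ^ s * ENNReal.ofReal (x - c) ≤ 2 ^ s * (ENNReal.ofReal (2 ^ s / (2 ^ s - 1)) * 2 ^ s * 2) *
      (M * (B * ENNReal.ofReal h ^ s * ENNReal.ofReal h)) := by
    calc F ^ s * ENNReal.ofReal (x - c) = ∑ j ∈ Finset.range N, F ^ s * ENNReal.ofReal (t (j+1) - t j) := by
          rw [← Finset.mul_sum, tel1]
      _ ≤ ∑ j ∈ Finset.range N, 2 ^ s * ((2 ^ j * Φ) ^ s * (M * ∑ i ∈ Finset.Ico j N, ν (Ioc (t i) (t (i+1))))) := by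
          refine Finset.sum_le_sum fun j hj => (s1 j).trans ?_
          gcongr
          refine (s2 j).trans ?_
          gcongr
          have := sum_Ioc ν t (Finset.mem_range.1 hj).le
          rwa [htN] at this
      _ = 2 ^ s * (M * ∑ j ∈ Finset.range N, ∑ i ∈ Finset.Ico j N, (2 ^ j * Φ) ^ s * ν (Ioc (t i) (t (i+1)))) := by
          rw [Finset.mul_sum, Finset.mul_sum]
          refine Finset.sum_congr rfl fun j _ => ?_
          rw [← Finset.mul_sum]; ring
      _ = 2 ^ s * (M * ∑ i ∈ Finset.range N, ∑ j ∈ Finset.range (i+1), (2 ^ j * Φ) ^ s * ν (Ioc (t i) (t (i+1)))) := by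
          congr 2
          apply Finset.sum_comm'
          intro i j
          simp only [Finset.mem_range, Finset.mem_Ico]
          omega
      _ ≤ 2 ^ s * (M * ∑ i ∈ Finset.range N, ENNReal.ofReal (2 ^ s / (2 ^ s - 1)) * 
          (2 ^ s * (B * ENNReal.ofReal h ^ s * ENNReal.ofReal (t (i+1) - (if i = 0 then a else t (i-1)))))) := by
          gcongr with i hi
          rw [← Finset.sum_mul]
          refine (mul_le_mul_left (geo hs i Φ) _).trans ?_
          rw [mul_assoc]
          exact mul_le_mul_right (s3 i) _
      _ = 2 ^ s * (M * (ENNReal.ofReal (2 ^ s / (2 ^ s - 1)) * (2 ^ s * (B * ENNReal.ofReal h ^ s * 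
          ∑ i ∈ Finset.range N, ENNReal.ofReal (t (i+1) - (if i = 0 then a else t (i-1))))))) := by
          simp only [Finset.mul_sum]
      _ ≤ 2 ^ s * (M * (ENNReal.ofReal (2 ^ s / (2 ^ s - 1)) * (2 ^ s * (B * ENNReal.ofReal h ^ s * 
          (2 * ENNReal.ofReal h))))) := by
          gcongr
      _ = _ := by ring
  have hxc : ENNReal.ofReal h = 2 * ENNReal.ofReal (x - c) := by
    rw [show h = 2 * (x - c) by rw [hh, hc]; ring, ENNReal.ofReal_mul (by norm_num)]; norm_num
  have hd0 : ENNReal.ofReal (x - c) ≠ 0 := by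
    rw [Ne, ENNReal.ofReal_eq_zero, not_le]; linarith
  rw [← ENNReal.mul_le_mul_iff_left hd0 ENNReal.ofReal_ne_top]
  refine main.trans (le_of_eq ?_)
  nth_rewrite 2 [hxc]
  ring

lemma hed_int {α : ℝ} (h0 : 0 < α) (h1 : α < 1) (K P : ℝ≥0∞) :
    ∫⁻ τ in Ioi (0:ℝ), ENNReal.ofReal (τ ^ (α - 2)) * min (K * ENNReal.ofReal τ) P ≤
      ENNReal.ofReal (1/α + 1/(1-α)) * (K ^ (1-α) * P ^ α) := by
  have h1' : 0 < 1 - α := by linarith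
  have hC : ENNReal.ofReal (1/α + 1/(1-α)) ≠ 0 := by
    rw [Ne, ENNReal.ofReal_eq_zero, not_le]; positivity
  by_cases hP0 : P = 0
  · simp [hP0]
  by_cases hK0 : K = 0
  · simp [hK0]
  by_cases hPt : P = ∞
  · rw [hPt, ENNReal.top_rpow_of_pos h0, ENNReal.mul_top, ENNReal.mul_top hC]
    · exact le_top
    · intro h; rw [ENNReal.rpow_eq_zero_iff] at h
      rcases h with h | h
      · exact hK0 h.1
      · linarith [h.2]
  by_cases hKt : K = ∞
  · rw [hKt, ENNReal.top_rpow_of_pos h1', ENNReal.top_mul, ENNReal.mul_top hC]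
    · exact le_top
    · intro h; rw [ENNReal.rpow_eq_zero_iff] at h
      rcases h with h | h
      · exact hP0 h.1
      · linarith [h.2]
  obtain ⟨k, hk, rfl⟩ : ∃ k : ℝ, 0 < k ∧ K = ENNReal.ofReal k :=
    ⟨K.toReal, ENNReal.toReal_pos hK0 hKt, (ENNReal.ofReal_toReal hKt).symm⟩
  obtain ⟨b, hb, rfl⟩ : ∃ k : ℝ, 0 < k ∧ P = ENNReal.ofReal k :=
    ⟨P.toReal, ENNReal.toReal_pos hP0 hPt, (ENNReal.ofReal_toReal hPt).symm⟩
  set T := b / k with hT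
  have hT0 : 0 < T := by positivity
  have e1 : k * T ^ α = k ^ (1-α) * b ^ α := by
    rw [hT, Real.div_rpow hb.le hk.le, Real.rpow_sub hk, Real.rpow_one]; field_simp
  have e2 : b * T ^ (α - 1) = k ^ (1-α) * b ^ α := by
    rw [← e1, Real.rpow_sub hT0, Real.rpow_one, hT]; field_simp
  rw [← Ioc_union_Ioi_eq_Ioi hT0.le]
  refine (lintegral_union_le _ _ _).trans ?_
  have p1 : ∫⁻ τ in Ioc (0:ℝ) T, ENNReal.ofReal (τ ^ (α - 2)) * min (ENNReal.ofReal k * ENNReal.ofReal τ) (ENNReal.ofReal b)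
      ≤ ENNReal.ofReal (1/α * (k ^ (1-α) * b ^ α)) := by
    calc _ ≤ ∫⁻ τ in Ioc (0:ℝ) T, ENNReal.ofReal k * ENNReal.ofReal (τ ^ (α - 1)) := by
          refine setLIntegral_mono' measurableSet_Ioc fun τ hτ => ?_
          refine (mul_le_mul_right (min_le_left _ _) _).trans (le_of_eq ?_)
          rw [← ENNReal.ofReal_mul hk.le, ← ENNReal.ofReal_mul (Real.rpow_nonneg hτ.1.le _), ← ENNReal.ofReal_mul hk.le]
          congr 1
          rw [show α - 1 = (α - 2) + 1 by ring, Real.rpow_add hτ.1, Real.rpow_one]; ring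
      _ = _ := by
          rw [lintegral_const_mul' _ _ ENNReal.ofReal_ne_top, lint_pow_fin h0 hT0.le,
            ENNReal.ofReal_rpow_of_nonneg hT0.le h0.le, ← ENNReal.ofReal_mul (by positivity), ← ENNReal.ofReal_mul hk.le, ← e1]
          congr 1; ring
  have p2 : ∫⁻ τ in Ioi T, ENNReal.ofReal (τ ^ (α - 2)) * min (ENNReal.ofReal k * ENNReal.ofReal τ) (ENNReal.ofReal b)
      ≤ ENNReal.ofReal (1/(1-α) * (k ^ (1-α) * b ^ α)) := by
    calc _ ≤ ∫⁻ τ in Ioi T, ENNReal.ofReal (τ ^ (α - 2)) * ENNReal.ofReal b := by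
          refine setLIntegral_mono' measurableSet_Ioi fun τ hτ => ?_
          exact mul_le_mul_right (min_le_right _ _) _
      _ = _ := by
          rw [lintegral_mul_const' _ _ ENNReal.ofReal_ne_top, 
            ← ofReal_integral_eq_lintegral_ofReal (integrableOn_Ioi_rpow_of_lt (by linarith) hT0),
            integral_Ioi_rpow_of_lt (by linarith) hT0, ← ENNReal.ofReal_mul', ← e2]
          · congr 1
            rw [show α - 2 + 1 = α - 1 by ring, show α - 1 = -(1-α) by ring]
            field_simp
          · exact hb.le
          · filter_upwards [ae_restrict_mem measurableSet_Ioi] with t ht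
            exact Real.rpow_nonneg (hT0.le.trans (le_of_lt ht)) _
  refine (add_le_add p1 p2).trans (le_of_eq ?_)
  rw [ENNReal.ofReal_rpow_of_pos hk, ENNReal.ofReal_rpow_of_pos hb, ← ENNReal.ofReal_mul (by positivity),
    ← ENNReal.ofReal_mul (by positivity), ← ENNReal.ofReal_add (by positivity) (by positivity)]
  congr 1; ring

lemma hedberg {α : ℝ} (h0 : 0 < α) (h1 : α < 1) (φ : ℝ → ℝ≥0∞) (hφ : Measurable φ) (x : ℝ) (K P : ℝ≥0∞)
    (hK : ∀ τ : ℝ, 0 < τ → ∫⁻ t in Ioc (x - 2*τ) (x - τ), φ t ≤ K * ENNReal.ofReal τ)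
    (hP : ∫⁻ t, φ t ≤ P) :
    ∫⁻ t in Iio x, φ t * ENNReal.ofReal ((x-t) ^ (α - 1)) ≤
      2 * ENNReal.ofReal (1/α + 1/(1-α)) * (K ^ (1-α) * P ^ α) := by
  have ker : ∀ t < x, ENNReal.ofReal ((x-t) ^ (α - 1)) ≤
      2 * ∫⁻ τ in Ioi (0:ℝ), (if x - 2*τ < t ∧ t ≤ x - τ then ENNReal.ofReal (τ ^ (α - 2)) else 0) := by
    intro t ht
    have hxt : 0 < x - t := by linarith
    calc ENNReal.ofReal ((x-t) ^ (α - 1)) = 2 * ∫⁻ τ in Ioc ((x-t)/2) (x-t), ENNReal.ofReal ((x-t) ^ (α - 2)) := by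
          rw [setLIntegral_const, Real.volume_Ioc, ← ENNReal.ofReal_mul (by positivity),
            show (2:ℝ≥0∞) = ENNReal.ofReal 2 by norm_num, ← ENNReal.ofReal_mul (by positivity)]
          congr 1
          rw [show α - 1 = (α - 2) + 1 by ring, Real.rpow_add hxt, Real.rpow_one]; ring
      _ ≤ 2 * ∫⁻ τ in Ioc ((x-t)/2) (x-t), (if x - 2*τ < t ∧ t ≤ x - τ then ENNReal.ofReal (τ ^ (α - 2)) else 0) := by
          refine mul_le_mul_right ?_ _
          refine setLIntegral_mono' measurableSet_Ioc fun τ hτ => ?_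
          rw [if_pos ⟨by linarith [hτ.1], by linarith [hτ.2]⟩]
          apply ENNReal.ofReal_le_ofReal
          exact Real.rpow_le_rpow_of_nonpos (by linarith [hτ.1]) hτ.2 (by linarith)
      _ ≤ _ := by
          refine mul_le_mul_right ?_ _
          refine lintegral_mono_set fun τ hτ => ?_
          have := hτ.1
          show 0 < τ
          linarith
  have hpw : Measurable fun t : ℝ => ENNReal.ofReal (t ^ (α - 2)) := by fun_prop
  have mk : Measurable (Function.uncurry fun (t τ : ℝ) => φ t * (if x - 2*τ < t ∧ t ≤ x - τ then ENNReal.ofReal (τ ^ (α - 2)) else 0)) := by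
    refine (hφ.comp measurable_fst).mul (Measurable.ite ?_ (hpw.comp measurable_snd) measurable_const)
    exact MeasurableSet.inter (s₁ := {a : ℝ × ℝ | x - 2*a.2 < a.1}) (s₂ := {a : ℝ × ℝ | a.1 ≤ x - a.2}) (measurableSet_lt (by fun_prop) (by fun_prop)) (measurableSet_le (by fun_prop) (by fun_prop))
  calc _ ≤ ∫⁻ t in Iio x, 2 * ∫⁻ τ in Ioi (0:ℝ), φ t * (if x - 2*τ < t ∧ t ≤ x - τ then ENNReal.ofReal (τ ^ (α - 2)) else 0) := by
        refine setLIntegral_mono' measurableSet_Iio fun t ht => ?_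
        refine (mul_le_mul_right (ker t ht) _).trans (le_of_eq ?_)
        rw [lintegral_const_mul, mul_left_comm]
        refine Measurable.ite ?_ hpw measurable_const
        exact MeasurableSet.inter (s₁ := {a : ℝ | x - 2*a < t}) (s₂ := {a : ℝ | t ≤ x - a}) (measurableSet_lt (by fun_prop) (by fun_prop)) (measurableSet_le (by fun_prop) (by fun_prop))
    _ ≤ ∫⁻ t, 2 * ∫⁻ τ in Ioi (0:ℝ), φ t * (if x - 2*τ < t ∧ t ≤ x - τ then ENNReal.ofReal (τ ^ (α - 2)) else 0) := 
        setLIntegral_le_lintegral _ _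
    _ = 2 * ∫⁻ τ in Ioi (0:ℝ), ∫⁻ t, φ t * (if x - 2*τ < t ∧ t ≤ x - τ then ENNReal.ofReal (τ ^ (α - 2)) else 0) := by
        rw [lintegral_const_mul' _ _ (by simp), lintegral_lintegral_swap mk.aemeasurable]
    _ ≤ 2 * ∫⁻ τ in Ioi (0:ℝ), ENNReal.ofReal (τ ^ (α - 2)) * min (K * ENNReal.ofReal τ) P := by
        refine mul_le_mul_right ?_ _
        refine setLIntegral_mono' measurableSet_Ioi fun τ hτ => ?_
        have e : ∀ t, φ t * (if x - 2*τ < t ∧ t ≤ x - τ then ENNReal.ofReal (τ ^ (α - 2)) else 0) =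
          ENNReal.ofReal (τ ^ (α - 2)) * (Ioc (x - 2*τ) (x - τ)).indicator φ t := by
          intro t
          rw [indicator_apply]
          simp only [mem_Ioc]
          split_ifs <;> simp [mul_comm]
        simp_rw [e]
        rw [lintegral_const_mul' _ _ ENNReal.ofReal_ne_top, lintegral_indicator measurableSet_Ioc]
        refine mul_le_mul_right (le_min (hK τ hτ) ?_) _
        exact (setLIntegral_le_lintegral _ _).trans hP
    _ ≤ _ := by
        rw [mul_assoc]
        exact mul_le_mul_right (hed_int h0 h1 K P) _

lemma core1 {α s : ℝ} (h0 : 0 < α) (h1 : α < 1) (hs : 0 < s) : ∃ C : ℝ≥0∞, C ≠ ∞ ∧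
    ∀ (u v : ℝ → ℝ≥0∞), Measurable u → Measurable v →
    (∀ x, u x ≠ 0) → (∀ x, u x ≠ ∞) → (∀ x, v x = u x ^ (-s)) →
    (∀ a b, (volume.withDensity u) (Ioc a b) ≠ ∞) → (∀ a b, (volume.withDensity v) (Ioc a b) ≠ ∞) →
    ∀ B : ℝ≥0∞, (∀ x h : ℝ, 0 < h → (volume.withDensity u) (Ioc (x-h) x) ^ s *
      (volume.withDensity v) (Ioc x (x+h)) ≤ B * ENNReal.ofReal h ^ (s+1)) →
    ∀ E : Set ℝ, MeasurableSet E → ∀ P, P = ∫⁻ t in E, u t →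
      ∫⁻ x, (∫⁻ t in Iio x, E.indicator u t * ENNReal.ofReal ((x-t) ^ (α - 1))) ^ ((1+s)/(1-α)) * v x ≤
        C * B ^ ((1+s)/s) * (P ^ (α * ((1+s)/(1-α))) * P) := by
  classical
  have h1' : 0 < 1 - α := by linarith
  obtain ⟨C1, hC1, hL⟩ := lerner hs
  obtain ⟨C2, hC2, hM2⟩ := strong (p := (1+s)/s) (by rw [lt_div_iff₀ hs]; linarith)
  obtain ⟨C3, hC3, hM3⟩ := strong (p := 1+s) (by linarith)
  set p' := (1+s)/(1-α) with hp'
  set D : ℝ≥0∞ := 2 * ENNReal.ofReal (1/α + 1/(1-α)) with hD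
  have hDt : D ≠ ∞ := by rw [hD]; finiteness
  have hp'0 : 0 < p' := by positivity
  have hrs : 0 < (1+s)/s := by positivity
  refine ⟨D ^ p' * 2 ^ (1+s) * C1 ^ ((1+s)/s) * C2 * C3, ?_, ?_⟩
  · have a1 : D ^ p' ≠ ∞ := ENNReal.rpow_ne_top_of_nonneg hp'0.le hDt
    have a2 : (2:ℝ≥0∞) ^ (1+s) ≠ ∞ := ENNReal.rpow_ne_top_of_nonneg (by linarith) (by simp)
    have a3 : C1 ^ ((1+s)/s) ≠ ∞ := ENNReal.rpow_ne_top_of_nonneg hrs.le hC1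
    finiteness
  intro u v hu hv hu0 hut hvu huf hvf B hB E hE P hP
  have hv0 : ∀ x, v x ≠ 0 := by
    intro x; rw [hvu, Ne, ENNReal.rpow_eq_zero_iff]
    rintro (h | h)
    · exact hu0 x h.1
    · exact hut x h.1
  have hvt : ∀ x, v x ≠ ∞ := by
    intro x; rw [hvu, Ne, ENNReal.rpow_eq_top_iff]
    rintro (h | h)
    · exact hu0 x h.1
    · exact hut x h.1
  set μ := volume.withDensity u with hμ
  set ν := volume.withDensity v with hν
  set f : ℝ → ℝ≥0∞ := E.indicator 1 with hf
  have hfm : Measurable f := measurable_one.indicator hE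
  set G := Mx μ f with hG
  have hGm : Measurable G := Mx_meas _ _
  set M := Mx ν (fun y => G y ^ s * (v y)⁻¹) with hM
  have hMm : Measurable M := Mx_meas _ _
  have hfu : ∀ t, u t * f t = E.indicator u t := by
    intro t; rw [hf, indicator_apply, indicator_apply]; split_ifs <;> simp
  set K : ℝ → ℝ≥0∞ := fun x => 2 * (C1 * B * M x) ^ (1/s) with hK
  have hR : ∀ x, ∫⁻ t in Iio x, E.indicator u t * ENNReal.ofReal ((x-t) ^ (α - 1)) ≤
      D * (K x ^ (1-α) * P ^ α) := by
    intro x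
    refine hedberg h0 h1 _ (hu.indicator hE) x (K x) P ?_ ?_
    · intro τ hτ
      have := hL u v hu hv hu0 hv0 hvt huf hvf B hB f (x - 2*τ) x (by linarith)
      rw [show (x - 2*τ + x)/2 = x - τ by ring, show x - (x - 2*τ) = 2*τ by ring,
        restrict_withDensity measurableSet_Ioc, lintegral_withDensity_eq_lintegral_mul _ hu hfm] at this
      simp only [Pi.mul_apply, hfu] at this
      rw [← ENNReal.rpow_le_rpow_iff hs]
      refine this.trans (le_of_eq ?_)
      rw [hK]; simp only
      rw [ENNReal.mul_rpow_of_nonneg _ _ hs.le, ENNReal.mul_rpow_of_nonneg _ _ hs.le, ← ENNReal.rpow_mul,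
        one_div_mul_cancel hs.ne', ENNReal.rpow_one, ENNReal.ofReal_mul (by norm_num),
        ENNReal.mul_rpow_of_nonneg _ _ hs.le]
      simp only [ENNReal.ofReal_ofNat]
      ring
    · rw [lintegral_indicator hE, hP]
  have hKp : ∀ x, (D * (K x ^ (1-α) * P ^ α)) ^ p' * v x =
      (D ^ p' * 2 ^ (1+s) * C1 ^ ((1+s)/s) * B ^ ((1+s)/s) * P ^ (α * p')) * (v x * M x ^ ((1+s)/s)) := by
    intro x
    rw [ENNReal.mul_rpow_of_nonneg D _ hp'0.le, ENNReal.mul_rpow_of_nonneg (K x ^ (1-α)) (P ^ α) hp'0.le, ← ENNReal.rpow_mul,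
      ← ENNReal.rpow_mul, show (1-α) * p' = 1+s by rw [hp']; field_simp]
    rw [hK]; simp only
    rw [ENNReal.mul_rpow_of_nonneg _ _ (by linarith : 0 ≤ 1+s), ← ENNReal.rpow_mul, one_div_mul_eq_div,
      ENNReal.mul_rpow_of_nonneg _ _ hrs.le, ENNReal.mul_rpow_of_nonneg _ _ hrs.le]
    ring
  calc _ ≤ ∫⁻ x, (D * (K x ^ (1-α) * P ^ α)) ^ p' * v x := by
        refine lintegral_mono fun x => mul_le_mul_left (ENNReal.rpow_le_rpow (hR x) hp'0.le) _
    _ = (D ^ p' * 2 ^ (1+s) * C1 ^ ((1+s)/s) * B ^ ((1+s)/s) * P ^ (α * p')) * ∫⁻ x, M x ^ ((1+s)/s) ∂ν := by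
        simp_rw [hKp]
        rw [lintegral_const_mul _ (by fun_prop), hν, lintegral_withDensity_eq_lintegral_mul _ hv (by fun_prop)]
        rfl
    _ ≤ (D ^ p' * 2 ^ (1+s) * C1 ^ ((1+s)/s) * B ^ ((1+s)/s) * P ^ (α * p')) * (C2 * (C3 * P)) := by
        refine mul_le_mul_right ?_ _
        refine (hM2 ν _ (by fun_prop)).trans (mul_le_mul_right ?_ _)
        have h3 := hM3 μ f hfm
        have e1 : ∫⁻ x, f x ^ (1+s) ∂μ = P := by
          rw [hμ, lintegral_withDensity_eq_lintegral_mul _ hu (by fun_prop), hP, ← lintegral_indicator hE]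
          congr 1; ext t
          rw [← hfu]
          simp only [Pi.mul_apply]
          congr 1
          rw [hf, indicator_apply]
          split_ifs
          · simp
          · rw [ENNReal.zero_rpow_of_pos (by linarith)]
        rw [e1] at h3
        refine le_trans (le_of_eq ?_) h3
        rw [hμ, hν, lintegral_withDensity_eq_lintegral_mul _ hu (hGm.pow_const _),
          lintegral_withDensity_eq_lintegral_mul _ hv (by fun_prop)]
        congr 1; ext t
        simp only [Pi.mul_apply]
        rw [ENNReal.mul_rpow_of_nonneg _ _ hrs.le, ← ENNReal.rpow_mul, mul_div_cancel₀ _ hs.ne', mul_left_comm,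
          mul_comm (u t)]
        congr 1
        rw [hvu, ← ENNReal.rpow_neg, neg_neg, ← ENNReal.rpow_mul, ← ENNReal.rpow_add _ _ (hu0 t) (hut t)]
        rw [mul_div_cancel₀ _ hs.ne']
        simp
    _ = _ := by ring

def kr (α x t : ℝ) : ℝ≥0∞ := if x < t then ENNReal.ofReal ((t-x) ^ (α - 1)) else 0

lemma kr_meas (α : ℝ) : Measurable (fun z : ℝ × ℝ => kr α z.1 z.2) := by
  unfold kr
  refine Measurable.ite (measurableSet_lt measurable_fst measurable_snd) ?_ measurable_const
  fun_prop

def WW (α : ℝ) (g : ℝ → ℝ≥0∞) (x : ℝ) : ℝ≥0∞ := ∫⁻ t, g t * kr α x t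

lemma WW_meas (α : ℝ) {g : ℝ → ℝ≥0∞} (hg : Measurable g) : Measurable (WW α g) := by
  unfold WW
  exact Measurable.lintegral_prod_right' (f := fun z : ℝ × ℝ => g z.2 * kr α z.1 z.2)
    ((hg.comp measurable_snd).mul (kr_meas α))

lemma WW_eq (α : ℝ) (g : ℝ → ℝ≥0∞) (x : ℝ) :
    WW α g x = ∫⁻ t in Ioi x, g t * ENNReal.ofReal ((t-x) ^ (α - 1)) := by
  rw [WW, ← lintegral_indicator measurableSet_Ioi]
  congr 1; ext t
  rw [indicator_apply, kr]
  simp only [mem_Ioi]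
  split_ifs <;> simp

lemma R_eq (α : ℝ) (g : ℝ → ℝ≥0∞) (x : ℝ) :
    ∫⁻ t, g t * kr α t x = ∫⁻ t in Iio x, g t * ENNReal.ofReal ((x-t) ^ (α - 1)) := by
  rw [← lintegral_indicator measurableSet_Iio]
  congr 1; ext t
  rw [indicator_apply, kr]
  simp only [mem_Iio]
  split_ifs <;> simp

lemma dual {α : ℝ} {g u : ℝ → ℝ≥0∞} (hg : Measurable g) (hu : Measurable u) (E : Set ℝ) (hE : MeasurableSet E)
    (l : ℝ≥0∞) (hl : ∀ x ∈ E, l ≤ WW α g x) :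
    l * ∫⁻ t in E, u t ≤ ∫⁻ x, g x * ∫⁻ t, E.indicator u t * kr α t x := by
  have hm := kr_meas α
  have hEu : Measurable (E.indicator u) := hu.indicator hE
  calc l * ∫⁻ t in E, u t = ∫⁻ t in E, l * u t := by rw [lintegral_const_mul _ hu]
    _ ≤ ∫⁻ t in E, WW α g t * u t := setLIntegral_mono' hE fun t ht => mul_le_mul_left (hl t ht) _
    _ = ∫⁻ t, E.indicator u t * WW α g t := by
        rw [← lintegral_indicator hE]; congr 1; ext t
        by_cases h : t ∈ E <;> simp [h, mul_comm]
    _ = ∫⁻ t, ∫⁻ x, g x * (E.indicator u t * kr α t x) := by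
        congr 1; ext t
        rw [WW, ← lintegral_const_mul]
        · congr 1; ext x; ring
        · exact hg.mul (hm.comp (measurable_const.prodMk measurable_id))
    _ = ∫⁻ x, ∫⁻ t, g x * (E.indicator u t * kr α t x) := by
        rw [lintegral_lintegral_swap]
        refine Measurable.aemeasurable ?_
        exact (hg.comp measurable_snd).mul ((hEu.comp measurable_fst).mul hm)
    _ = _ := by
        congr 1; ext x
        rw [lintegral_const_mul]
        exact hEu.mul (hm.comp (measurable_id.prodMk measurable_const))

lemma core2 {p q α : ℝ} (hα : 0 < α) (hα1 : α < 1) (hp : 1 < p) (hpα : p < 1 / α)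
    (hq : q = p / (1 - α * p)) : ∃ C : ℝ≥0∞, C ≠ ∞ ∧
    ∀ (u v : ℝ → ℝ≥0∞), Measurable u → Measurable v →
    (∀ x, u x ≠ 0) → (∀ x, u x ≠ ∞) → (∀ x, v x = u x ^ (-((p/(p-1))/q))) →
    (∀ a b, (volume.withDensity u) (Ioc a b) ≠ ∞) → (∀ a b, (volume.withDensity v) (Ioc a b) ≠ ∞) →
    ∀ A : ℝ≥0∞, (∀ x h : ℝ, 0 < h → (volume.withDensity u) (Ioc (x-h) x) ^ ((p/(p-1))/q) *
      (volume.withDensity v) (Ioc x (x+h)) ≤ A ^ ((p/(p-1))/q) * ENNReal.ofReal h ^ ((p/(p-1))/q+1)) →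
    ∀ g : ℝ → ℝ≥0∞, Measurable g → ∀ l : ℝ≥0∞,
      l * (∫⁻ x in {x | l < WW α g x}, u x) ^ (1/q) ≤
        C * A ^ (1-α) * (∫⁻ x, g x ^ p * u x ^ (p/q)) ^ (1/p) := by
  have hαp : 0 < 1 - α * p := by
    rw [lt_div_iff₀ hα] at hpα; linarith
  have hp0 : 0 < p := by linarith
  have hp1 : 0 < p - 1 := by linarith
  have hq0 : 0 < q := by rw [hq]; positivity
  have hqi : 1/q = 1/p - α := by rw [hq]; field_simp
  have hqi' : 1 = q * (1/p - α) := by rw [← hqi]; field_simp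
  have hcj : p.HolderConjugate (p/(p-1)) := Real.HolderConjugate.conjExponent hp
  set p' := p/(p-1) with hp'
  have hp'0 : 0 < p' := by positivity
  have hp'i : 1/p' = 1 - 1/p := by rw [hp']; field_simp
  set s := p'/q with hs
  have hs0 : 0 < s := by positivity
  have hr : (1+s)/(1-α) = p' := by
    have : 1 - α ≠ 0 := by linarith
    rw [div_eq_iff this, hs, div_eq_mul_one_div p' q, hqi, hp']
    field_simp
    ring
  obtain ⟨C, hC, H⟩ := core1 hα hα1 hs0
  have hp'i0 : 0 ≤ 1/p' := by positivity
  refine ⟨C ^ (1/p'), ENNReal.rpow_ne_top_of_nonneg hp'i0 hC, ?_⟩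
  intro u v hu hv hu0 hut hvu huf hvf A hA g hg l
  have key : ∀ E : Set ℝ, MeasurableSet E → E ⊆ {x | l < WW α g x} → ∫⁻ t in E, u t ≠ ∞ →
      l * (∫⁻ x in E, u x) ^ (1/q) ≤
        C ^ (1/p') * A ^ (1-α) * (∫⁻ x, g x ^ p * u x ^ (p/q)) ^ (1/p) := by
    intro E hE hEs hPt
    have hd := dual hg hu E hE l (fun x hx => le_of_lt (hEs hx))
    have hc := H u v hu hv hu0 hut hvu huf hvf _ hA E hE _ rfl
    set P := ∫⁻ t in E, u t with hP
    by_cases hP0 : P = 0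
    · rw [hP0, ENNReal.zero_rpow_of_pos (by positivity)]; simp
    set R : ℝ → ℝ≥0∞ := fun x => ∫⁻ t, E.indicator u t * kr α t x with hR
    have hRm : Measurable R := by
      refine Measurable.lintegral_prod_left' (f := fun z : ℝ × ℝ => E.indicator u z.1 * kr α z.1 z.2) ?_
      exact ((hu.indicator hE).comp measurable_fst).mul (kr_meas α)
    rw [hr] at hc
    simp_rw [← R_eq α (E.indicator u)] at hc
    change ∫⁻ x, R x ^ p' * v x ≤ _ at hc
    change _ ≤ ∫⁻ x, g x * R x at hd
    clear_value R
    have hho := ENNReal.lintegral_mul_le_Lp_mul_Lq volume hcj (f := fun x => g x * u x ^ (1/q))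
      (g := fun x => R x * u x ^ (-(1/q))) (hg.mul (hu.pow_const _)).aemeasurable
      (hRm.mul (hu.pow_const _)).aemeasurable
    have e1 : ∀ x, (g x * u x ^ (1/q)) * (R x * u x ^ (-(1/q))) = g x * R x := by
      intro x
      have : u x ^ (1/q) * u x ^ (-(1/q)) = 1 := by
        rw [← ENNReal.rpow_add _ _ (hu0 x) (hut x)]; simp
      calc _ = g x * R x * (u x ^ (1/q) * u x ^ (-(1/q))) := by ring
        _ = _ := by rw [this, mul_one]
    have e2 : ∀ x, (g x * u x ^ (1/q)) ^ p = g x ^ p * u x ^ (p/q) := by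
      intro x
      rw [ENNReal.mul_rpow_of_nonneg _ _ hp0.le, ← ENNReal.rpow_mul, one_div_mul_eq_div]
    have e3 : ∀ x, (R x * u x ^ (-(1/q))) ^ p' = R x ^ p' * v x := by
      intro x
      rw [ENNReal.mul_rpow_of_nonneg _ _ hp'0.le, ← ENNReal.rpow_mul, hvu]
      congr 2; rw [hs]; ring
    simp only [Pi.mul_apply, e1, e2, e3] at hho
    set N := (∫⁻ x, g x ^ p * u x ^ (p/q)) ^ (1/p) with hN
    have h4 : (∫⁻ x, R x ^ p' * v x) ^ (1/p') ≤ C ^ (1/p') * A ^ (1-α) * P ^ (1 - 1/q) := by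
      refine (ENNReal.rpow_le_rpow hc hp'i0).trans (le_of_eq ?_)
      rw [ENNReal.mul_rpow_of_nonneg _ _ hp'i0, ENNReal.mul_rpow_of_nonneg _ _ hp'i0,
        ENNReal.mul_rpow_of_nonneg _ _ hp'i0, ← ENNReal.rpow_mul, ← ENNReal.rpow_mul, ← ENNReal.rpow_mul,
        ← ENNReal.rpow_add _ _ hP0 hPt]
      congr 2
      · congr 1
        have : 1 + s = p' * (1-α) := by
          rw [← hr]; have : 1 - α ≠ 0 := by linarith
          field_simp
        rw [this]; field_simp
      · rw [mul_assoc, mul_one_div_cancel hp'0.ne', hqi, hp'i]; ring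
    have h5 : l * P ≤ N * (C ^ (1/p') * A ^ (1-α) * P ^ (1 - 1/q)) :=
      hd.trans (hho.trans (mul_le_mul_right h4 _))
    have h6 : P * P ^ (-(1 - 1/q)) = P ^ (1/q) := by
      conv_lhs => rw [← ENNReal.rpow_one P]
      rw [← ENNReal.rpow_mul, one_mul, ← ENNReal.rpow_add _ _ hP0 hPt]; congr 1; ring
    have h7 : P ^ (1 - 1/q) * P ^ (-(1 - 1/q)) = 1 := by
      rw [← ENNReal.rpow_add _ _ hP0 hPt]; simp
    calc l * P ^ (1/q) = l * P * P ^ (-(1 - 1/q)) := by rw [← h6, mul_assoc]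
      _ ≤ N * (C ^ (1/p') * A ^ (1-α) * P ^ (1 - 1/q)) * P ^ (-(1 - 1/q)) := mul_le_mul_left h5 _
      _ = N * (C ^ (1/p') * A ^ (1-α)) * (P ^ (1 - 1/q) * P ^ (-(1 - 1/q))) := by ring
      _ = _ := by rw [h7, mul_one, mul_comm]
  set S : Set ℝ := {x | l < WW α g x} with hS
  have hSm : MeasurableSet S := measurableSet_lt measurable_const (WW_meas α hg)
  have hU : S = ⋃ n : ℕ, S ∩ Ioc (-(n:ℝ)) n := by
    ext x
    simp only [mem_iUnion, mem_inter_iff, exists_and_left, mem_Ioc]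
    refine ⟨fun h => ⟨h, ?_⟩, fun h => h.1⟩
    obtain ⟨n, hn⟩ := exists_nat_gt |x|
    exact ⟨n, by linarith [neg_abs_le x], (le_abs_self x).trans hn.le⟩
  have hmono : Monotone fun n : ℕ => S ∩ Ioc (-(n:ℝ)) n := by
    intro m n hmn
    have : (m:ℝ) ≤ n := by exact_mod_cast hmn
    exact inter_subset_inter_right _ (Ioc_subset_Ioc (by linarith) this)
  have hsup : ∫⁻ x in S, u x = ⨆ n : ℕ, ∫⁻ x in S ∩ Ioc (-(n:ℝ)) n, u x := by
    conv_lhs => rw [hU]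
    exact setLIntegral_iUnion_of_directed _ hmono.directed_le
  have hq' : 0 < 1/q := by positivity
  rw [hsup]
  have : (⨆ n : ℕ, ∫⁻ x in S ∩ Ioc (-(n:ℝ)) n, u x) ^ (1/q) = ⨆ n : ℕ, (∫⁻ x in S ∩ Ioc (-(n:ℝ)) n, u x) ^ (1/q) :=
    (ENNReal.orderIsoRpow (1/q) hq').map_iSup _
  rw [this, ENNReal.mul_iSup]
  refine iSup_le fun n => key _ (hSm.inter measurableSet_Ioc) inter_subset_left ?_
  refine ne_top_of_le_ne_top (huf (-(n:ℝ)) n) ?_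
  rw [withDensity_apply _ measurableSet_Ioc]
  exact lintegral_mono_set inter_subset_right

lemma nonmeas (α : ℝ) (F : ℝ → ℝ≥0∞) : ∃ g : ℝ → ℝ≥0∞, Measurable g ∧ g ≤ F ∧
    ∀ x, ∫⁻ t in Ioi x, F t * ENNReal.ofReal ((t-x) ^ (α - 1)) ≤ WW α g x := by
  obtain ⟨g, hg, hgF, hgi⟩ := exists_measurable_le_forall_setLIntegral_eq volume F
  refine ⟨g, hg, hgF, fun x => ?_⟩
  have hk : Measurable fun t : ℝ => ENNReal.ofReal ((t-x) ^ (α - 1)) := by fun_prop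
  have hkt : ∀ᵐ t ∂(volume.restrict (Ioi x)), ENNReal.ofReal ((t-x) ^ (α - 1)) < ∞ :=
    Eventually.of_forall fun t => ENNReal.ofReal_lt_top
  have e := lintegral_withDensity_eq_lintegral_mul_non_measurable (volume.restrict (Ioi x)) hk hkt F
  obtain ⟨φ, hφ, hφF, hφi⟩ := exists_measurable_le_lintegral_eq
    ((volume.restrict (Ioi x)).withDensity fun t : ℝ => ENNReal.ofReal ((t-x) ^ (α - 1))) F
  have hle : φ ≤ᵐ[volume] g := by
    refine ae_le_of_forall_setLIntegral_le_of_sigmaFinite hφ fun s _ _ => ?_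
    rw [← hgi s]
    exact lintegral_mono hφF
  rw [e, lintegral_withDensity_eq_lintegral_mul _ hk hφ] at hφi
  simp only [Pi.mul_apply] at hφi
  rw [WW_eq]
  calc _ = ∫⁻ t in Ioi x, ENNReal.ofReal ((t-x) ^ (α - 1)) * F t := by simp_rw [mul_comm]
    _ = ∫⁻ t in Ioi x, ENNReal.ofReal ((t-x) ^ (α - 1)) * φ t := hφi
    _ ≤ _ := by
        refine lintegral_mono_ae ?_
        filter_upwards [ae_restrict_of_ae hle] with t ht
        rw [mul_comm]
        exact mul_le_mul_left ht _

lemma unavg {s h : ℝ} (hs : 0 < s) (hh : 0 < h) {U V A : ℝ≥0∞}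
    (H : ((ENNReal.ofReal h)⁻¹ * U) * ((ENNReal.ofReal h)⁻¹ * V) ^ (1/s) ≤ A) :
    U ^ s * V ≤ A ^ s * ENNReal.ofReal h ^ (s+1) := by
  have h0 : ENNReal.ofReal h ≠ 0 := by simpa using hh
  have ht : ENNReal.ofReal h ≠ ∞ := ENNReal.ofReal_ne_top
  generalize ENNReal.ofReal h = k at *
  have H2 := ENNReal.rpow_le_rpow H hs.le
  rw [ENNReal.mul_rpow_of_nonneg _ _ hs.le, ← ENNReal.rpow_mul, one_div_mul_cancel hs.ne', ENNReal.rpow_one,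
    ENNReal.mul_rpow_of_nonneg _ _ hs.le, ENNReal.inv_rpow] at H2
  have hks0 : k ^ s ≠ 0 := by
    rw [Ne, ENNReal.rpow_eq_zero_iff]; rintro (h | h)
    · exact h0 h.1
    · exact ht h.1
  have hkst : k ^ s ≠ ∞ := ENNReal.rpow_ne_top_of_nonneg hs.le ht
  rw [ENNReal.rpow_add _ _ h0 ht, ENNReal.rpow_one]
  calc U ^ s * V = ((k ^ s)⁻¹ * k ^ s) * (k⁻¹ * k) * (U ^ s * V) := by
        rw [ENNReal.inv_mul_cancel hks0 hkst, ENNReal.inv_mul_cancel h0 ht]; simp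
    _ = ((k ^ s)⁻¹ * U ^ s * (k⁻¹ * V)) * (k ^ s * k) := by ring
    _ ≤ _ := mul_le_mul_left H2 _

end Wey

/-- Weak-type sharp bound for the Weyl operator:
`‖W_α‖_{L^p_{w^p} → L^{q,∞}_{w^q}} ≤ c ‖w‖_{A_{p,q}^+}^{1-α}`. -/
theorem stmt12 (p q α : ℝ) (hα : 0 < α) (hα1 : α < 1) (hp : 1 < p) (hpα : p < 1 / α)
    (hq : q = p / (1 - α * p)) :
    ∃ c : ℝ, 0 < c ∧
      ∀ w : ℝ → ℝ, IsWeight w → apqPlusChar p q w ≠ ∞ →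
        ∀ f : ℝ → ℝ,
          wkNormW q (fun x => w x ^ q) (Walpha α f) ≤
            ENNReal.ofReal c * apqPlusChar p q w ^ (1 - α) *
              lnormW p (fun x => w x ^ p) (fun x => ENNReal.ofReal |f x|) := by
  obtain ⟨C, hC, H⟩ := Wey.core2 hα hα1 hp hpα hq
  refine ⟨C.toReal + 1, by positivity, ?_⟩
  intro w hw hA f
  have hp0 : 0 < p := by linarith
  have hp1 : 0 < p - 1 := by linarith
  have hαp : 0 < 1 - α * p := by
    rw [lt_div_iff₀ hα] at hpα; linarith
  have hq0 : 0 < q := by rw [hq]; positivity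
  have hp'0 : 0 < p / (p-1) := by positivity
  set s := (p / (p-1)) / q with hs
  have hs0 : 0 < s := by positivity
  have hs1 : q / (p / (p-1)) = 1/s := by rw [hs]; field_simp
  obtain ⟨w1, hw1m, hw1p, hw1e⟩ : ∃ w1 : ℝ → ℝ, Measurable w1 ∧ (∀ x, 0 < w1 x) ∧ ∀ᵐ x, w x = w1 x := by
    have hae : AEMeasurable w volume := hw.2.aestronglyMeasurable.aemeasurable
    refine ⟨fun x => if 0 < hae.mk w x then hae.mk w x else 1, ?_, ?_, ?_⟩
    · exact Measurable.ite (measurableSet_lt measurable_const hae.measurable_mk) hae.measurable_mk measurable_const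
    · intro x; dsimp only; split_ifs with h
      · exact h
      · exact one_pos
    · filter_upwards [hw.1, hae.ae_eq_mk] with x h1 h2
      rw [← h2, if_pos h1]
  set A := apqPlusChar p q w with hAdef
  set u : ℝ → ℝ≥0∞ := fun x => ENNReal.ofReal (w1 x ^ q) with hu
  set v : ℝ → ℝ≥0∞ := fun x => ENNReal.ofReal (w1 x ^ (-(p / (p-1)))) with hv
  have hum : Measurable u := by rw [hu]; fun_prop
  have hvm : Measurable v := by rw [hv]; fun_prop
  have hu0 : ∀ x, u x ≠ 0 := by
    intro x; rw [hu]; simpa using Real.rpow_pos_of_pos (hw1p x) _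
  have hv0 : ∀ x, v x ≠ 0 := by
    intro x; rw [hv]; simpa using Real.rpow_pos_of_pos (hw1p x) _
  have hut : ∀ x, u x ≠ ∞ := fun x => ENNReal.ofReal_ne_top
  have hvu : ∀ x, v x = u x ^ (-s) := by
    intro x
    simp only [hu, hv]
    rw [ENNReal.ofReal_rpow_of_pos (Real.rpow_pos_of_pos (hw1p x) _), ← Real.rpow_mul (hw1p x).le]
    congr 2; rw [hs]; field_simp
  have hup : ∀ x, u x ^ (p/q) = ENNReal.ofReal (w1 x ^ p) := by
    intro x
    simp only [hu]
    rw [ENNReal.ofReal_rpow_of_pos (Real.rpow_pos_of_pos (hw1p x) _), ← Real.rpow_mul (hw1p x).le]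
    congr 2; field_simp
  have hB : ∀ x h : ℝ, 0 < h → (volume.withDensity u) (Ioc (x-h) x) ^ s *
      (volume.withDensity v) (Ioc x (x+h)) ≤ A ^ s * ENNReal.ofReal h ^ (s+1) := by
    intro x h hh
    apply Wey.unavg hs0 hh
    have h1 : avgIoc (fun t => w t ^ q) (x - h) x *
      avgIoc (fun t => w t ^ (-(p / (p - 1)))) x (x + h) ^ (q / (p / (p - 1))) ≤ A := by
      rw [hAdef, apqPlusChar]
      exact le_iSup_of_le x (le_iSup_of_le h (le_iSup_of_le hh le_rfl))
    have eu : lintIoc (fun t => w t ^ q) (x-h) x = (volume.withDensity u) (Ioc (x-h) x) := by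
      rw [Wey.wd_apply, lintIoc]
      refine lintegral_congr_ae (ae_restrict_of_ae ?_)
      filter_upwards [hw1e] with t ht
      rw [ht]
    have ev : lintIoc (fun t => w t ^ (-(p / (p - 1)))) x (x+h) = (volume.withDensity v) (Ioc x (x+h)) := by
      rw [Wey.wd_apply, lintIoc]
      refine lintegral_congr_ae (ae_restrict_of_ae ?_)
      filter_upwards [hw1e] with t ht
      rw [ht]
    rw [avgIoc, avgIoc, eu, ev, show x - (x-h) = h by ring, show x + h - x = h by ring, hs1] at h1
    exact h1
  have hfin : ∀ h : ℝ, A ^ s * ENNReal.ofReal h ^ (s+1) ≠ ∞ := by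
    intro h
    exact ENNReal.mul_ne_top (ENNReal.rpow_ne_top_of_nonneg hs0.le hA)
      (ENNReal.rpow_ne_top_of_nonneg (by linarith) ENNReal.ofReal_ne_top)
  have huf : ∀ a b, (volume.withDensity u) (Ioc a b) ≠ ∞ := by
    intro a b hab
    rcases le_or_gt b a with h | h
    · simp [Ioc_eq_empty_of_le h] at hab
    have h1 := hB b (b-a) (by linarith)
    rw [show b - (b-a) = a by ring, hab, ENNReal.top_rpow_of_pos hs0,
      ENNReal.top_mul (Wey.wd_pos hvm hv0 (by linarith)), top_le_iff] at h1
    exact hfin _ h1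
  have hvf : ∀ a b, (volume.withDensity v) (Ioc a b) ≠ ∞ := by
    intro a b hab
    rcases le_or_gt b a with h | h
    · simp [Ioc_eq_empty_of_le h] at hab
    have h1 := hB a (b-a) (by linarith)
    rw [show a + (b-a) = b by ring, hab, ENNReal.mul_top, top_le_iff] at h1
    · exact hfin _ h1
    · rw [Ne, ENNReal.rpow_eq_zero_iff]
      rintro (h' | h')
      · exact Wey.wd_pos hum hu0 (by linarith) h'.1
      · linarith [h'.2]
  obtain ⟨g, hgm, hgF, hgW⟩ := Wey.nonmeas α (fun x => ENNReal.ofReal |f x|)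
  have hWle : ∀ x, Walpha α f x ≤ Wey.WW α g x := by
    intro x
    refine le_trans (le_of_eq ?_) (hgW x)
    rw [Walpha]
    refine lintegral_congr fun t => ?_
    rw [ENNReal.ofReal_mul (abs_nonneg _)]
  have hC' : C ≤ ENNReal.ofReal (C.toReal + 1) := by
    rw [← ENNReal.ofReal_toReal hC]
    apply ENNReal.ofReal_le_ofReal
    rw [ENNReal.ofReal_toReal hC]; linarith
  rw [wkNormW]
  refine iSup₂_le fun l hl => ?_
  have hmain := H u v hum hvm hu0 hut hvu huf hvf A hB g hgm (ENNReal.ofReal l)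
  have hL : ∫⁻ x in {x : ℝ | ENNReal.ofReal l < Walpha α f x}, ENNReal.ofReal (w x ^ q) ≤
      ∫⁻ x in {x | ENNReal.ofReal l < Wey.WW α g x}, u x := by
    calc _ ≤ ∫⁻ x in {x | ENNReal.ofReal l < Wey.WW α g x}, ENNReal.ofReal (w x ^ q) :=
          lintegral_mono_set fun x hx => lt_of_lt_of_le hx (hWle x)
      _ = _ := by
          refine lintegral_congr_ae (ae_restrict_of_ae ?_)
          filter_upwards [hw1e] with t ht
          rw [ht]
  have hR : (∫⁻ x, g x ^ p * u x ^ (p/q)) ^ (1/p) ≤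
      lnormW p (fun x => w x ^ p) (fun x => ENNReal.ofReal |f x|) := by
    rw [lnormW]
    refine ENNReal.rpow_le_rpow (lintegral_mono_ae ?_) (by positivity)
    filter_upwards [hw1e] with t ht
    rw [hup, ht]
    exact mul_le_mul_left (ENNReal.rpow_le_rpow (hgF t) hp0.le) _
  calc _ ≤ ENNReal.ofReal l * (∫⁻ x in {x | ENNReal.ofReal l < Wey.WW α g x}, u x) ^ (1/q) :=
        mul_le_mul_right (ENNReal.rpow_le_rpow hL (by positivity)) _
    _ ≤ _ := hmain
    _ ≤ _ := mul_le_mul' (mul_le_mul_left hC' _) hR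

end
end
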